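/- In the setup below, x ∈ {u3, u4} and the edge xy belongs to {e, f}; that is, the unique neighbour x in H of the end v1 of the direct connection P is u3 or u4, and x is adjacent to y. -/

import Mathlib

open SimpleGraph

variable {V : Type*}

/-- The list of internal vertices of a walk (its support minus the two ends). -/
def interiorL {G : SimpleGraph V} {a b : V} (p : G.Walk a b) : List V :=
  p.support.tail.dropLast

/-- `p` is an induced path of `G`: a path such that the only edges of `G` between
vertices of `p` are the edges of `p`. -/
def IsInducedPath (G : SimpleGraph V) {a b : V} (p : G.Walk a b) : Prop :=
  p.IsPath ∧ ∀ x ∈ p.support, ∀ y ∈ p.support, G.Adj x y → s(x, y) ∈ p.edges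

/-- A hole of `G`: an induced (chordless) cycle of length at least 4. -/
def IsHole (G : SimpleGraph V) {v : V} (c : G.Walk v v) : Prop :=
  c.IsCycle ∧ 4 ≤ c.length ∧
    ∀ x ∈ c.support, ∀ y ∈ c.support, G.Adj x y → s(x, y) ∈ c.edges

/-- An odd hole of `G`: a hole of odd length. -/
def IsOddHole (G : SimpleGraph V) {v : V} (c : G.Walk v v) : Prop :=
  IsHole G c ∧ Odd c.length

/-- `G ∈ 𝒢ℓ`: `G` has girth `2ℓ+1` and every odd hole of `G` has length exactly `2ℓ+1`
(equivalently, no odd hole of length at least `2ℓ+3`). -/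
def InGFamily (ℓ : ℕ) (G : SimpleGraph V) : Prop :=
  G.egirth = (2 * ℓ + 1 : ℕ) ∧
    ∀ (v : V) (c : G.Walk v v), IsOddHole G c → c.length = 2 * ℓ + 1

/-- `G` is `k`-vertex-critical: `χ(G) = k` and `χ(G − v) < k` for every vertex `v`. -/
def VertexCritical (k : ℕ) (G : SimpleGraph V) : Prop :=
  G.chromaticNumber = (k : ℕ∞) ∧
    ∀ v : V, (G.induce ({v}ᶜ : Set V)).chromaticNumber < (k : ℕ∞)

/-- An odd `K₄`-subdivision in `G`: four distinct branch vertices `u1, u2, u3, u4`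
joined by six internally disjoint paths (the arrises), such that the four face cycles
are all odd holes of `G`. -/
structure OddK4 (G : SimpleGraph V) where
  u1 : V
  u2 : V
  u3 : V
  u4 : V
  /-- the arris joining `u1` and `u2` -/
  P1 : G.Walk u1 u2
  /-- the arris joining `u3` and `u4` -/
  P2 : G.Walk u3 u4
  /-- the arris joining `u2` and `u3` -/
  Q1 : G.Walk u2 u3
  /-- the arris joining `u1` and `u4` -/
  Q2 : G.Walk u1 u4
  /-- the arris joining `u1` and `u3` -/
  L1 : G.Walk u1 u3
  /-- the arris joining `u2` and `u4` -/
  L2 : G.Walk u2 u4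
  hP1 : P1.IsPath
  hP2 : P2.IsPath
  hQ1 : Q1.IsPath
  hQ2 : Q2.IsPath
  hL1 : L1.IsPath
  hL2 : L2.IsPath
  /-- the four branch vertices are pairwise distinct -/
  hnodup : List.Nodup [u1, u2, u3, u4]
  /-- the interiors of the six arrises are pairwise disjoint -/
  hdisj : List.Pairwise List.Disjoint
    [interiorL P1, interiorL P2, interiorL Q1, interiorL Q2, interiorL L1, interiorL L2]
  /-- no branch vertex lies in the interior of an arris -/
  hbranch : ∀ x ∈ interiorL P1 ++ interiorL P2 ++ interiorL Q1 ++ interiorL Q2 ++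
      interiorL L1 ++ interiorL L2, x ∉ [u1, u2, u3, u4]
  /-- the face `u1u2u3` is an odd hole of `G` -/
  face1 : IsOddHole G (P1.append (Q1.append L1.reverse))
  /-- the face `u1u2u4` is an odd hole of `G` -/
  face2 : IsOddHole G (P1.append (L2.append Q2.reverse))
  /-- the face `u1u3u4` is an odd hole of `G` -/
  face3 : IsOddHole G (L1.append (P2.append Q2.reverse))
  /-- the face `u2u3u4` is an odd hole of `G` -/
  face4 : IsOddHole G (Q1.append (P2.append L2.reverse))

/-- The subgraph of `G` formed by an odd `K₄`-subdivision. -/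
def OddK4.toSubgraph {G : SimpleGraph V} (K : OddK4 G) : G.Subgraph :=
  K.P1.toSubgraph ⊔ K.P2.toSubgraph ⊔ K.Q1.toSubgraph ⊔ K.Q2.toSubgraph ⊔
    K.L1.toSubgraph ⊔ K.L2.toSubgraph

/-- The vertex set of an odd `K₄`-subdivision. -/
def OddK4.verts {G : SimpleGraph V} (K : OddK4 G) : Set V :=
  K.toSubgraph.verts

/-- `P1, P2` form a pair of longest arrises of the odd `K₄`-subdivision `K`. -/
def OddK4.longestPair {G : SimpleGraph V} (K : OddK4 G) : Prop :=
  K.Q1.length ≤ K.P1.length ∧ K.Q2.length ≤ K.P1.length ∧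
    K.L1.length ≤ K.P1.length ∧ K.L2.length ≤ K.P1.length ∧
    K.Q1.length ≤ K.P2.length ∧ K.Q2.length ≤ K.P2.length ∧
    K.L1.length ≤ K.P2.length ∧ K.L2.length ≤ K.P2.length

/-- The difference `d(H) = |P1| − min(|Q1|, |L1|)` of an odd `K₄`-subdivision
(labelled so that `P1, P2` is a pair of longest arrises). -/
def OddK4.diff {G : SimpleGraph V} (K : OddK4 G) : ℕ :=
  K.P1.length - min K.Q1.length K.L1.length

/-- A walk of `G` bundled with its two ends. -/
structure Arc (G : SimpleGraph V) where
  a : V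
  b : V
  w : G.Walk a b

namespace Arc

variable {G : SimpleGraph V}

/-- The number of edges of an arc. -/
def len (e : Arc G) : ℕ := e.w.length

/-- The arc traversed backwards. -/
def flip (e : Arc G) : Arc G := ⟨e.b, e.a, e.w.reverse⟩

/-- The arc itself, or its reversal if the flag is `false`. -/
def orient (e : Arc G) (d : Bool) : Arc G := if d then e else e.flip

/-- `v` is an end of the arc. -/
def IsEnd (e : Arc G) (v : V) : Prop := v = e.a ∨ v = e.b

/-- Two arcs meet only in common ends. -/
def Disj (e f : Arc G) : Prop :=
  ∀ v ∈ e.w.support, v ∈ f.w.support → e.IsEnd v ∧ f.IsEnd v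

@[simp] lemma len_mk {a b : V} (w : G.Walk a b) : (⟨a, b, w⟩ : Arc G).len = w.length := rfl

@[simp] lemma mem_support_orient (e : Arc G) (d : Bool) (v : V) :
    v ∈ (e.orient d).w.support ↔ v ∈ e.w.support := by
  cases d <;> simp [orient, flip]

@[simp] lemma mem_edges_orient (e : Arc G) (d : Bool) (s : Sym2 V) :
    s ∈ (e.orient d).w.edges ↔ s ∈ e.w.edges := by
  cases d <;> simp [orient, flip]

@[simp] lemma isPath_orient (e : Arc G) (d : Bool) : (e.orient d).w.IsPath ↔ e.w.IsPath := by
  cases d <;> simp [orient, flip]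

@[simp] lemma isEnd_orient (e : Arc G) (d : Bool) (v : V) :
    (e.orient d).IsEnd v ↔ e.IsEnd v := by
  cases d <;> simp [orient, flip, IsEnd, or_comm]

lemma ne_orient (e : Arc G) (d : Bool) (h : e.a ≠ e.b) : (e.orient d).a ≠ (e.orient d).b := by
  cases d <;> simp [orient, flip, h, h.symm]

lemma Disj.symm {e f : Arc G} (h : e.Disj f) : f.Disj e :=
  fun v hv hv' => (h v hv' hv).symm

lemma IsEnd.mem_support {e : Arc G} {v : V} (h : e.IsEnd v) : v ∈ e.w.support := by
  rcases h with rfl | rfl <;> simp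

lemma one_le_len {e : Arc G} (h : e.a ≠ e.b) : 1 ≤ e.len := by
  by_contra hc
  exact h (Walk.eq_of_length_eq_zero (by simpa [len] using hc))

end Arc

/-- A list of arcs that are paths with distinct ends, pairwise meeting only in common ends. -/
structure Frame {G : SimpleGraph V} (L : List (Arc G)) : Prop where
  path : ∀ e ∈ L, e.w.IsPath
  ne : ∀ e ∈ L, e.a ≠ e.b
  disj : L.Pairwise Arc.Disj

/-- A frame such that every edge of `G` between its vertices is an edge of one of its arcs. -/
structure IndFrame {G : SimpleGraph V} (L : List (Arc G)) : Prop extends Frame L where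
  ind : ∀ e ∈ L, ∀ f ∈ L, ∀ v ∈ e.w.support, ∀ w ∈ f.w.support, G.Adj v w →
    ∃ g ∈ L, s(v, w) ∈ g.w.edges

/-- The arcs of the list are consecutive and lead from the first vertex to the second one. -/
def ArcChain {G : SimpleGraph V} : V → List (Arc G) → V → Prop
  | u, [], v => u = v
  | u, e :: L, v => e.a = u ∧ ArcChain e.b L v

section Frames

variable {G : SimpleGraph V}

lemma Frame.disj_of_ne {L : List (Arc G)} (h : Frame L) {e f : Arc G} (he : e ∈ L) (hf : f ∈ L)
    (hne : e ≠ f) : e.Disj f :=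
  haveI : Std.Symm (Arc.Disj (G := G)) := ⟨fun _ _ => Arc.Disj.symm⟩
  List.Pairwise.forall h.disj he hf hne

lemma Frame.isEnd_of_isEnd {L : List (Arc G)} (h : Frame L) {e f : Arc G} (he : e ∈ L)
    (hf : f ∈ L) {v : V} (hv : e.IsEnd v) (hvf : v ∈ f.w.support) : f.IsEnd v := by
  by_cases hne : e = f
  · exact hne ▸ hv
  · exact (h.disj_of_ne he hf hne v hv.mem_support hvf).2

lemma Frame.one_le_len {L : List (Arc G)} (h : Frame L) : ∀ e ∈ L, 1 ≤ e.len :=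
  fun e he => Arc.one_le_len (h.ne e he)

lemma Frame.disj_of_getElem? {L : List (Arc G)} (h : Frame L) {i j : ℕ} {e f : Arc G}
    (he : L[i]? = some e) (hf : L[j]? = some f) (hij : i ≠ j) : e.Disj f := by
  obtain ⟨hi, rfl⟩ := List.getElem?_eq_some_iff.1 he
  obtain ⟨hj, rfl⟩ := List.getElem?_eq_some_iff.1 hf
  rcases lt_or_gt_of_ne hij with hlt | hlt
  · exact List.pairwise_iff_getElem.1 h.disj _ _ hi hj hlt
  · exact (List.pairwise_iff_getElem.1 h.disj _ _ hj hi hlt).symm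

/-- The arcs of `L` with given indices and orientations. -/
def pickArcs (L : List (Arc G)) (is : List (ℕ × Bool)) : List (Arc G) :=
  is.filterMap fun i => L[i.1]?.map (Arc.orient · i.2)

lemma mem_pickArcs {L : List (Arc G)} {is : List (ℕ × Bool)} {e : Arc G} :
    e ∈ pickArcs L is ↔ ∃ i ∈ is, ∃ g, L[i.1]? = some g ∧ g.orient i.2 = e := by
  simp [pickArcs]

lemma Frame.pick {L : List (Arc G)} (h : Frame L) (is : List (ℕ × Bool))
    (hnd : (is.map Prod.fst).Nodup) : Frame (pickArcs L is) where
  path e he := by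
    obtain ⟨i, -, g, hg, rfl⟩ := mem_pickArcs.1 he
    simpa using h.path _ (List.mem_of_getElem? hg)
  ne e he := by
    obtain ⟨i, -, g, hg, rfl⟩ := mem_pickArcs.1 he
    exact Arc.ne_orient _ _ (h.ne _ (List.mem_of_getElem? hg))
  disj := by
    rw [pickArcs, List.pairwise_filterMap]
    rw [List.Nodup, List.pairwise_map] at hnd
    refine hnd.imp fun {i j} hij => ?_
    simp only [Option.map_eq_some_iff]
    rintro _ ⟨e, he, rfl⟩ _ ⟨f, hf, rfl⟩ v hv hv'
    simpa using h.disj_of_getElem? he hf hij v (by simpa using hv) (by simpa using hv')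

lemma Arc.len_eq_one {e : Arc G} (hp : e.w.IsPath) {v w : V} (hv : e.IsEnd v) (hw : e.IsEnd w)
    (h : s(v, w) ∈ e.w.edges) : e.len = 1 := by
  have hvw : v ≠ w := (e.w.adj_of_mem_edges h).ne
  refine hp.length_eq_one_of_mem_edges ?_
  rcases hv with rfl | rfl <;> rcases hw with rfl | rfl
  · exact absurd rfl hvw
  · exact h
  · rwa [Sym2.eq_swap]
  · exact absurd rfl hvw

lemma IndFrame.pick {L : List (Arc G)} (h : IndFrame L) (is : List (ℕ × Bool))
    (hnd : (is.map Prod.fst).Nodup)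
    (hch : ∀ p ∈ L.zipIdx, p.2 ∉ is.map Prod.fst → p.1.len = 1 →
      (∃ g ∈ pickArcs L is, g.IsEnd p.1.a) → (∃ g ∈ pickArcs L is, g.IsEnd p.1.b) → False) :
    IndFrame (pickArcs L is) where
  toFrame := h.toFrame.pick is hnd
  ind e he f hf v hv w hw hvw := by
    obtain ⟨i, hi, e, he', rfl⟩ := mem_pickArcs.1 he
    obtain ⟨j, hj, f, hf', rfl⟩ := mem_pickArcs.1 hf
    simp only [Arc.mem_support_orient] at hv hw
    obtain ⟨g, hg, hs⟩ := h.ind e (List.mem_of_getElem? he') f (List.mem_of_getElem? hf') v hv w hw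
      hvw
    obtain ⟨k, hk'⟩ := List.mem_iff_getElem?.1 hg
    by_cases hk : k ∈ is.map Prod.fst
    · obtain ⟨k', hkm, rfl⟩ := List.mem_map.1 hk
      exact ⟨_, mem_pickArcs.2 ⟨_, hkm, _, hk', rfl⟩, by simpa using hs⟩
    · exfalso
      have aux : ∀ i ∈ is, i.1 ≠ k := fun i hi hik => hk (hik ▸ List.mem_map_of_mem hi)
      obtain ⟨hvi, hvk⟩ := h.disj_of_getElem? he' hk' (aux i hi) v hv
        (Walk.fst_mem_support_of_mem_edges _ hs)
      obtain ⟨hwj, hwk⟩ := h.disj_of_getElem? hf' hk' (aux j hj) w hw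
        (Walk.snd_mem_support_of_mem_edges _ hs)
      have hne : v ≠ w := hvw.ne
      have hvp : ∃ g ∈ pickArcs L is, g.IsEnd v := ⟨_, he, by simpa using hvi⟩
      have hwp : ∃ g ∈ pickArcs L is, g.IsEnd w := ⟨_, hf, by simpa using hwj⟩
      refine hch (g, k) (List.mem_zipIdx_iff_getElem?.2 hk') hk
        (Arc.len_eq_one (h.path _ hg) hvk hwk hs) ?_ ?_
      · rcases hvk with rfl | rfl
        · exact hvp
        · rcases hwk with rfl | rfl
          · exact hwp
          · exact absurd rfl hne
      · rcases hvk with rfl | rfl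
        · rcases hwk with rfl | rfl
          · exact absurd rfl hne
          · exact hwp
        · exact hvp

lemma isPath_append {a k b : V} {p : G.Walk a k} {q : G.Walk k b} (hp : p.IsPath)
    (hq : q.IsPath) (h : ∀ v ∈ p.support, v ∈ q.support → v = k) : (p.append q).IsPath := by
  rw [Walk.isPath_def, Walk.support_append]
  have hqn := hq.support_nodup
  rw [← Walk.cons_tail_support] at hqn
  refine List.Nodup.append hp.support_nodup (List.nodup_cons.1 hqn).2 ?_
  intro v hv hv'
  have := h v hv (List.mem_of_mem_tail hv')
  subst this
  exact (List.nodup_cons.1 hqn).1 hv'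

lemma Frame.merge {a k b : V} {p : G.Walk a k} {q : G.Walk k b} {L : List (Arc G)}
    (h : Frame (⟨a, k, p⟩ :: ⟨k, b, q⟩ :: L)) (hab : a ≠ b) (hk : ∀ e ∈ L, ¬ e.IsEnd k) :
    Frame (⟨a, b, p.append q⟩ :: L) where
  path := by
    simp only [List.forall_mem_cons]
    have h1 := h.path
    have h2 := h.ne
    have h3 := h.disj
    simp only [List.forall_mem_cons, List.pairwise_cons] at h1 h2 h3
    refine ⟨isPath_append h1.1 h1.2.1 fun v hv hv' => ?_, h1.2.2⟩
    have := h3.1.1 v hv hv'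
    simp only [Arc.IsEnd] at this
    grind
  ne := by
    have h2 := h.ne
    simp only [List.forall_mem_cons] at h2 ⊢
    exact ⟨hab, h2.2.2⟩
  disj := by
    have h3 := h.disj
    simp only [List.forall_mem_cons, List.pairwise_cons] at h3 ⊢
    refine ⟨fun e he v hv hv' => ?_, h3.2.2⟩
    have hke := hk e he
    have e1 := h3.1.2 e he v
    have e2 := h3.2.1 e he v
    simp only [Walk.mem_support_append_iff, Arc.IsEnd] at *
    grind

lemma IndFrame.merge {a k b : V} {p : G.Walk a k} {q : G.Walk k b} {L : List (Arc G)}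
    (h : IndFrame (⟨a, k, p⟩ :: ⟨k, b, q⟩ :: L)) (hab : a ≠ b) (hk : ∀ e ∈ L, ¬ e.IsEnd k) :
    IndFrame (⟨a, b, p.append q⟩ :: L) where
  toFrame := h.toFrame.merge hab hk
  ind := by
    have aux : ∀ v, (∃ e ∈ ((⟨a, b, p.append q⟩ :: L) : List (Arc G)), v ∈ e.w.support) →
        ∃ e ∈ ((⟨a, k, p⟩ :: ⟨k, b, q⟩ :: L) : List (Arc G)), v ∈ e.w.support := by
      intro v
      simp only [List.exists_mem_cons_iff, Walk.mem_support_append_iff]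
      tauto
    intro e he f hf v hv w hw hvw
    obtain ⟨e', he', hv'⟩ := aux v ⟨e, he, hv⟩
    obtain ⟨f', hf', hw'⟩ := aux w ⟨f, hf, hw⟩
    have := h.ind e' he' f' hf' v hv' w hw' hvw
    simp only [List.exists_mem_cons_iff, Walk.edges_append, List.mem_append] at this ⊢
    tauto

lemma Frame.split {a k b : V} {p : G.Walk a k} {q : G.Walk k b} {L : List (Arc G)}
    (h : Frame (⟨a, b, p.append q⟩ :: L)) (hka : k ≠ a) (hkb : k ≠ b) :
    Frame (⟨a, k, p⟩ :: ⟨k, b, q⟩ :: L) where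
  path := by
    have h1 := h.path
    simp only [List.forall_mem_cons] at h1 ⊢
    exact ⟨h1.1.of_append_left, h1.1.of_append_right, h1.2⟩
  ne := by
    have h1 := h.ne
    simp only [List.forall_mem_cons] at h1 ⊢
    exact ⟨hka.symm, hkb, h1.2⟩
  disj := by
    have h3 := h.disj
    have h1 := h.path
    simp only [List.forall_mem_cons, List.pairwise_cons] at h1 h3 ⊢
    have hpq : ∀ v, v ∈ p.support → v ∈ q.support → v = k := by
      intro v hv hv'
      by_contra hne
      exact h1.1.ne_of_mem_support_of_append hne hv hv' rfl
    refine ⟨⟨fun v hv hv' => ?_, fun e he v hv hv' => ?_⟩, fun e he v hv hv' => ?_, h3.2⟩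
    · have := hpq v hv hv'
      simp [Arc.IsEnd, this]
    · have := h3.1 e he v (by simp [hv]) hv'
      have hb := hpq b
      simp only [Arc.IsEnd] at this ⊢
      grind [Walk.end_mem_support]
    · have := h3.1 e he v (by simp [hv]) hv'
      have hb := hpq a
      simp only [Arc.IsEnd] at this ⊢
      grind [Walk.start_mem_support]

lemma IndFrame.split {a k b : V} {p : G.Walk a k} {q : G.Walk k b} {L : List (Arc G)}
    (h : IndFrame (⟨a, b, p.append q⟩ :: L)) (hka : k ≠ a) (hkb : k ≠ b) :
    IndFrame (⟨a, k, p⟩ :: ⟨k, b, q⟩ :: L) where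
  toFrame := h.toFrame.split hka hkb
  ind := by
    have aux : ∀ v, (∃ e ∈ ((⟨a, k, p⟩ :: ⟨k, b, q⟩ :: L) : List (Arc G)), v ∈ e.w.support) →
        ∃ e ∈ ((⟨a, b, p.append q⟩ :: L) : List (Arc G)), v ∈ e.w.support := by
      intro v
      simp only [List.exists_mem_cons_iff, Walk.mem_support_append_iff]
      tauto
    intro e he f hf v hv w hw hvw
    obtain ⟨e', he', hv'⟩ := aux v ⟨e, he, hv⟩
    obtain ⟨f', hf', hw'⟩ := aux w ⟨f, hf, hw⟩
    have := h.ind e' he' f' hf' v hv' w hw' hvw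
    simp only [List.exists_mem_cons_iff, Walk.edges_append, List.mem_append] at this ⊢
    tauto

lemma ArcChain.isEnd {L : List (Arc G)} : ∀ {u v : V}, ArcChain u L v → ∀ e ∈ L, ∀ k,
    e.IsEnd k → k ∈ L.map Arc.a ∨ k = v := by
  induction L with
  | nil => simp
  | cons f L ih =>
    rintro u v ⟨rfl, hc⟩ e he k hk
    rcases List.mem_cons.1 he with rfl | he
    · rcases hk with rfl | rfl
      · simp
      · cases L with
        | nil => exact Or.inr hc
        | cons g L => simp [hc.1]
    · rcases ih hc e he k hk with h | h
      · exact Or.inl (List.mem_cons_of_mem _ h)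
      · exact Or.inr h

/-- A closed chain of arcs of a frame is a cycle. -/
lemma Frame.exists_cycle (L : List (Arc G)) : ∀ (e : Arc G), Frame (e :: L) → L ≠ [] →
    ArcChain e.b L e.a → ((e :: L).map Arc.a).Nodup → 3 ≤ ((e :: L).map Arc.len).sum →
    ∃ c : G.Walk e.a e.a, c.IsCycle ∧ c.length = ((e :: L).map Arc.len).sum ∧
      (∀ v ∈ c.support, ∃ g ∈ e :: L, v ∈ g.w.support) ∧
      (∀ g ∈ e :: L, ∀ s ∈ g.w.edges, s ∈ c.edges) := by
  induction L with
  | nil => simp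
  | cons f L ih =>
    rintro ⟨a, k, p⟩ h - ⟨hf, hc⟩ hnd h3
    obtain ⟨k', b, q⟩ := f
    dsimp only at hf
    subst hf
    cases L with
    | nil =>
      dsimp only [ArcChain] at hc
      subst hc
      have h1 := h.path
      have h2 := h.disj
      simp only [List.forall_mem_cons, List.pairwise_cons] at h1 h2
      simp only [List.map_cons, Arc.len_mk, List.map_nil, List.sum_cons, List.sum_nil] at h3 ⊢
      refine ⟨p.append q, ?_, by simp, by simp, by simp +contextual⟩
      refine h1.1.isCycle_append h1.2.1 ?_ (by omega)
      intro v hv hv'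
      have := h2.1.1 v (List.mem_of_mem_tail hv) (List.mem_of_mem_tail hv')
      have n1 := h1.1.support_nodup
      have n2 := h1.2.1.support_nodup
      rw [← Walk.cons_tail_support] at n1 n2
      simp only [Arc.IsEnd] at this
      grind
    | cons g L =>
      obtain ⟨b', d, r⟩ := g
      have hb := hc.1
      dsimp only at hb
      subst hb
      have hk : ∀ e ∈ (⟨b', d, r⟩ :: L : List (Arc G)), ¬ e.IsEnd k' := by
        intro e he hek
        have hm := hc.isEnd e he k' hek
        simp only [List.map_cons, List.nodup_cons] at hnd
        rcases hm with hm | rfl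
        · exact hnd.2.1 hm
        · simp at hnd
      have hab : a ≠ b' := by
        simp only [List.map_cons, List.nodup_cons] at hnd
        rintro rfl
        simp at hnd
      obtain ⟨c, hcyc, hlen, hs, he⟩ := ih ⟨a, b', p.append q⟩ (h.merge hab hk) (by simp) hc
        (by
          simp only [List.map_cons, List.nodup_cons, List.mem_cons, not_or] at hnd ⊢
          exact ⟨hnd.1.2, hnd.2.2⟩)
        (by
          simp only [List.map_cons, Arc.len_mk, List.sum_cons, Walk.length_append] at h3 ⊢
          omega)
      refine ⟨c, hcyc, ?_, ?_, ?_⟩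
      · simp only [List.map_cons, Arc.len_mk, List.sum_cons, Walk.length_append] at hlen ⊢
        omega
      · intro v hv
        have := hs v hv
        simp only [List.exists_mem_cons_iff, Walk.mem_support_append_iff] at this ⊢
        tauto
      · simp only [List.forall_mem_cons, Walk.edges_append, List.mem_append] at he ⊢
        exact ⟨fun s hs => he.1 s (Or.inl hs), fun s hs => he.1 s (Or.inr hs), he.2⟩

lemma InGFamily.le_length {ℓ : ℕ} (hG : InGFamily ℓ G) {v : V} {c : G.Walk v v}
    (hc : c.IsCycle) : 2 * ℓ + 1 ≤ c.length := by
  have := egirth_le_length hc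
  rw [hG.1] at this
  exact_mod_cast this

lemma InGFamily.le_add_length {ℓ : ℕ} (hG : InGFamily ℓ G) {u v : V} {p q : G.Walk u v}
    (hp : p.IsPath) (hq : q.IsPath) (h : p ≠ q) : 2 * ℓ + 1 ≤ p.length + q.length := by
  obtain ⟨w, -, -, c, hc, hl⟩ := hp.exists_isCycle_length_le_add_of_ne hq h
  exact (hG.le_length hc).trans hl

lemma IndFrame.length_eq {ℓ : ℕ} (hℓ : 2 ≤ ℓ) (hG : InGFamily ℓ G) {e : Arc G} {M : List (Arc G)}
    (h : IndFrame (e :: M)) (hne : M ≠ [])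
    (hch : ArcChain e.b M e.a) (hst : ((e :: M).map Arc.a).Nodup)
    (h3 : 3 ≤ ((e :: M).map Arc.len).sum) :
    2 * ℓ + 1 ≤ ((e :: M).map Arc.len).sum ∧
    (((e :: M).map Arc.len).sum % 2 = 1 → ((e :: M).map Arc.len).sum = 2 * ℓ + 1) := by
  obtain ⟨c, hc, hl, hs, he⟩ := Frame.exists_cycle M e h.toFrame hne hch hst h3
  have hg := hG.le_length hc
  rw [← hl]
  refine ⟨hg, fun ho => hG.2 _ c ⟨⟨hc, by omega, fun x hx y hy hxy => ?_⟩, Nat.odd_iff.2 ho⟩⟩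
  obtain ⟨f, hf, hxf⟩ := hs x hx
  obtain ⟨g, hg, hyg⟩ := hs y hy
  obtain ⟨k, hk, hsk⟩ := h.ind f hf g hg x hxf y hyg hxy
  exact he k hk _ hsk

end Frames

section Cycles

variable {G : SimpleGraph V}

/-- The arcs of the list form a closed chain. -/
def ClosedChain : List (Arc G) → Prop
  | [] => False
  | e :: L => L ≠ [] ∧ ArcChain e.b L e.a

@[simp] lemma Arc.orient_true (e : Arc G) : e.orient true = e := rfl

@[simp] lemma Arc.orient_false_mk {a b : V} (w : G.Walk a b) :
    (⟨a, b, w⟩ : Arc G).orient false = ⟨b, a, w.reverse⟩ := rfl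

/-- `n` is a possible length of an induced cycle of a graph of `𝒢ℓ`. -/
def CycLen (ℓ n : ℕ) : Prop := 2 * ℓ + 1 ≤ n ∧ (n % 2 = 1 → n = 2 * ℓ + 1)

lemma IndFrame.cycLen {ℓ : ℕ} (hℓ : 2 ≤ ℓ) (hG : InGFamily ℓ G) {L : List (Arc G)}
    (h : IndFrame L) (is : List (ℕ × Bool)) {n : ℕ}
    (hcd : ∀ p ∈ L.zipIdx, p.2 ∉ is.map Prod.fst → p.1.len = 1 →
      p.1.a ∈ (pickArcs L is).map Arc.a → p.1.b ∈ (pickArcs L is).map Arc.a → False)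
    (hst : ((pickArcs L is).map Arc.a).Nodup)
    (hn : ((pickArcs L is).map Arc.len).sum = n := by simp [pickArcs] <;> omega)
    (hcl : ClosedChain (pickArcs L is) := by simp [ClosedChain, ArcChain, pickArcs])
    (hnd : (is.map Prod.fst).Nodup := by decide)
    (h3 : 3 ≤ n := by omega) : CycLen ℓ n := by
  have key : ∀ g ∈ pickArcs L is, ∀ v, g.IsEnd v → v ∈ (pickArcs L is).map Arc.a := by
    cases hp : pickArcs L is with
    | nil => simp
    | cons e M =>
      rw [hp] at hcl
      intro g hg v hv
      rcases List.mem_cons.1 hg with rfl | hg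
      · rcases hv with rfl | rfl
        · simp
        · obtain ⟨hne, hc⟩ := hcl
          cases M with
          | nil => exact absurd rfl hne
          | cons f M => simp [hc.1]
      · rcases hcl.2.isEnd g hg v hv with h | rfl
        · exact List.mem_cons_of_mem _ h
        · simp
  have hI := h.pick is hnd fun p hp hpi hp1 ha hb => by
    obtain ⟨g, hg, hga⟩ := ha
    obtain ⟨g', hg', hgb⟩ := hb
    exact hcd p hp hpi hp1 (key g hg _ hga) (key g' hg' _ hgb)
  cases hp : pickArcs L is with
  | nil =>
    rw [hp] at hcl
    exact hcl.elim
  | cons e M =>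
    rw [hp] at hI hcl hst hn
    exact hn ▸ hI.length_eq hℓ hG hcl.1 hcl.2 hst (hn ▸ h3)

lemma Frame.le_sum {ℓ : ℕ} (hG : InGFamily ℓ G) {L : List (Arc G)}
    (h : Frame L) (is : List (ℕ × Bool)) {n : ℕ}
    (hst : ((pickArcs L is).map Arc.a).Nodup)
    (hn : ((pickArcs L is).map Arc.len).sum = n := by simp [pickArcs] <;> omega)
    (hcl : ClosedChain (pickArcs L is) := by simp [ClosedChain, ArcChain, pickArcs])
    (hnd : (is.map Prod.fst).Nodup := by decide)
    (h3 : 3 ≤ n := by omega) : 2 * ℓ + 1 ≤ n := by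
  have hI := h.pick is hnd
  cases hp : pickArcs L is with
  | nil =>
    rw [hp] at hcl
    exact hcl.elim
  | cons e M =>
    rw [hp] at hI hcl hst hn
    obtain ⟨c, hc, hl, -⟩ := Frame.exists_cycle M e hI hcl.1 hcl.2 hst (hn ▸ h3)
    exact hn ▸ hl ▸ hG.le_length hc

lemma Frame.isCycle_append {a b : V} {p : G.Walk a b} {q : G.Walk b a}
    (h : Frame [⟨a, b, p⟩, ⟨b, a, q⟩]) (h3 : 3 ≤ p.length + q.length) :
    (p.append q).IsCycle := by
  have h1 := h.path
  have h2 := h.disj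
  simp only [List.forall_mem_cons, List.pairwise_cons] at h1 h2
  refine h1.1.isCycle_append h1.2.1 ?_ (by omega)
  intro v hv hv'
  have := h2.1.1 v (List.mem_of_mem_tail hv) (List.mem_of_mem_tail hv')
  have n1 := h1.1.support_nodup
  have n2 := h1.2.1.support_nodup
  rw [← Walk.cons_tail_support] at n1 n2
  simp only [Arc.IsEnd] at this
  grind

lemma IndFrame.isOddHole {ℓ : ℕ} (hℓ : 2 ≤ ℓ) (hG : InGFamily ℓ G) {a b c : V} {p : G.Walk a b}
    {q : G.Walk b c} {r : G.Walk c a} (h : IndFrame [⟨a, b, p⟩, ⟨b, c, q⟩, ⟨c, a, r⟩])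
    (ho : (p.length + q.length + r.length) % 2 = 1) : IsOddHole G (p.append (q.append r)) := by
  have h1 := h.one_le_len
  have hac := h.ne
  simp only [List.forall_mem_cons, Arc.len_mk] at h1 hac
  have hm := h.merge hac.2.2.1.symm (by
    simp only [List.forall_mem_cons, Arc.IsEnd]
    grind)
  have hc := hm.isCycle_append (by simp; omega)
  rw [← Walk.append_assoc] at hc
  have hg := hG.le_length hc
  refine ⟨⟨hc, by omega, fun x hx y hy hxy => ?_⟩,
    Nat.odd_iff.2 (by simpa [add_assoc] using ho)⟩
  have aux : ∀ z, z ∈ (p.append (q.append r)).support →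
      ∃ e ∈ [(⟨a, b, p⟩ : Arc G), ⟨b, c, q⟩, ⟨c, a, r⟩], z ∈ e.w.support := by
    intro z
    simp
  obtain ⟨e, he, hxe⟩ := aux x hx
  obtain ⟨f, hf, hyf⟩ := aux y hy
  simpa using h.ind e he f hf x hxe y hyf hxy

/-- A path of length at least two whose inner vertices lie outside `X` and have no neighbours in
`X` or on the path except along the path. -/
structure Ear (X : Set V) {x y : V} (p : G.Walk x y) : Prop where
  path : p.IsPath
  two_le : 2 ≤ p.length
  notMem : ∀ v ∈ p.support, v ≠ x → v ≠ y → v ∉ X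
  ind : ∀ v ∈ p.support, v ≠ x → v ≠ y → ∀ w, w ∈ p.support ∨ w ∈ X → G.Adj v w →
    s(v, w) ∈ p.edges

lemma Ear.mono {X Y : Set V} {x y : V} {p : G.Walk x y} (h : Ear X p) (hXY : Y ⊆ X) : Ear Y p where
  path := h.path
  two_le := h.two_le
  notMem v hv h1 h2 hY := h.notMem v hv h1 h2 (hXY hY)
  ind v hv h1 h2 w hw := h.ind v hv h1 h2 w (hw.imp_right (@hXY w))

lemma Ear.ne {X : Set V} {x y : V} {p : G.Walk x y} (h : Ear X p) : x ≠ y := by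
  rintro rfl
  have := h.two_le
  have := Walk.length_eq_zero_iff.2 (Walk.isPath_iff_nil.1 h.path)
  omega

lemma Ear.reverse {X : Set V} {x y : V} {p : G.Walk x y} (h : Ear X p) : Ear X p.reverse where
  path := h.path.reverse
  two_le := by simpa using h.two_le
  notMem v hv h1 h2 := h.notMem v (by simpa using hv) h2 h1
  ind v hv h1 h2 w hw hvw := by
    simpa using h.ind v (by simpa using hv) h2 h1 w (by simpa using hw) hvw

/-- The vertices covered by a list of arcs. -/
def arcVerts (L : List (Arc G)) : Set V := {v | ∃ e ∈ L, v ∈ e.w.support}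

lemma Frame.cons {L : List (Arc G)} (h : Frame L) {x y : V} {p : G.Walk x y} (hp : p.IsPath)
    (hxy : x ≠ y) (hX : ∀ v ∈ p.support, v ≠ x → v ≠ y → v ∉ arcVerts L)
    (hx : ∃ e ∈ L, e.IsEnd x) (hy : ∃ e ∈ L, e.IsEnd y) : Frame (⟨x, y, p⟩ :: L) where
  path := List.forall_mem_cons.2 ⟨hp, h.path⟩
  ne := List.forall_mem_cons.2 ⟨hxy, h.ne⟩
  disj := by
    refine List.pairwise_cons.2 ⟨fun e he v hv hve => ?_, h.disj⟩
    obtain ⟨f, hf, hxf⟩ := hx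
    obtain ⟨g, hg, hyg⟩ := hy
    by_cases hvx : v = x
    · exact ⟨Or.inl hvx, h.isEnd_of_isEnd hf he (hvx ▸ hxf) hve⟩
    by_cases hvy : v = y
    · exact ⟨Or.inr hvy, h.isEnd_of_isEnd hg he (hvy ▸ hyg) hve⟩
    exact absurd ⟨e, he, hve⟩ (hX v hv hvx hvy)

lemma IndFrame.addEar {L : List (Arc G)} (h : IndFrame L) {x y : V} {p : G.Walk x y}
    (hp : Ear (arcVerts L) p) (hx : ∃ e ∈ L, e.IsEnd x) (hy : ∃ e ∈ L, e.IsEnd y) :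
    IndFrame (⟨x, y, p⟩ :: L) where
  toFrame := h.toFrame.cons hp.path hp.ne hp.notMem hx hy
  ind := by
    obtain ⟨f, hf, hxf⟩ := hx
    obtain ⟨g, hg, hyg⟩ := hy
    have old : ∀ v ∈ arcVerts L, ∀ w ∈ arcVerts L, G.Adj v w →
        ∃ g ∈ (⟨x, y, p⟩ :: L : List (Arc G)), s(v, w) ∈ g.w.edges := by
      rintro v ⟨e, he, hv⟩ w ⟨e', he', hw⟩ hvw
      obtain ⟨k, hk, hs⟩ := h.ind e he e' he' v hv w hw hvw
      exact ⟨k, List.mem_cons_of_mem _ hk, hs⟩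
    have cls : ∀ v e, e ∈ (⟨x, y, p⟩ :: L : List (Arc G)) → v ∈ e.w.support →
        v ∈ arcVerts L ∨ v ∈ p.support ∧ v ≠ x ∧ v ≠ y := by
      intro v e he hv
      by_cases hvx : v = x
      · exact Or.inl ⟨f, hf, hvx ▸ hxf.mem_support⟩
      by_cases hvy : v = y
      · exact Or.inl ⟨g, hg, hvy ▸ hyg.mem_support⟩
      rcases List.mem_cons.1 he with rfl | he
      · exact Or.inr ⟨hv, hvx, hvy⟩
      · exact Or.inl ⟨e, he, hv⟩
    intro e he e' he' v hv w hw hvw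
    rcases cls v e he hv with h1 | ⟨h1, h1x, h1y⟩
    · rcases cls w e' he' hw with h2 | ⟨h2, h2x, h2y⟩
      · exact old v h1 w h2 hvw
      · refine ⟨_, List.mem_cons_self, ?_⟩
        rw [Sym2.eq_swap]
        exact hp.ind w h2 h2x h2y v (Or.inr h1) hvw.symm
    · exact ⟨_, List.mem_cons_self, hp.ind v h1 h1x h1y w
        ((cls w e' he' hw).symm.imp (fun h => h.1) id) hvw⟩

end Cycles

section EarLengths

variable {G : SimpleGraph V}

lemma ear_branch_false {ℓ : ℕ} (hℓ : 5 ≤ ℓ) (hG : InGFamily ℓ G) {u1 u2 u3 u4 y : V}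
    {E : G.Walk u3 y} {P1 : G.Walk u1 u2} {T1 : G.Walk u3 y} {T2 : G.Walk y u4}
    {Q1 : G.Walk u2 u3} {Q2 : G.Walk u1 u4} {L1 : G.Walk u1 u3} {L2 : G.Walk u2 u4}
    (h : IndFrame [⟨u3, y, E⟩, ⟨u1, u2, P1⟩, ⟨u3, y, T1⟩, ⟨y, u4, T2⟩, ⟨u2, u3, Q1⟩, ⟨u1, u4, Q2⟩,
      ⟨u1, u3, L1⟩, ⟨u2, u4, L2⟩])
    (hu : [u1, u2, u3, u4, y].Nodup) (hE : 2 ≤ E.length) (hT : 2 ≤ T1.length)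
    (hP : T1.length + T2.length = P1.length) (hQ : Q2.length = Q1.length)
    (hL : L2.length = L1.length) (hs : P1.length + Q1.length + L1.length = 2 * ℓ + 1)
    (hPl : P1.length ≤ ℓ) (hQl : Q1.length ≤ ℓ) (hLl : L1.length ≤ ℓ) : False := by
  have hp := h.one_le_len
  simp only [List.forall_mem_cons, Arc.len_mk] at hp
  simp only [List.nodup_cons, List.mem_cons, List.not_mem_nil, or_false, not_or] at hu
  have c1 : CycLen ℓ (E.length + T1.length) :=
    h.cycLen (by omega) hG [(0, true), (2, false)] (by simp [pickArcs]; grind)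
      (by simp [pickArcs]; grind)
  have c2 : CycLen ℓ (E.length + T2.length + Q1.length + L1.length) :=
    h.cycLen (by omega) hG [(0, true), (3, true), (5, false), (6, true)] (by simp [pickArcs]; grind)
      (by simp [pickArcs]; grind)
  have c3 : 2 ≤ L1.length → CycLen ℓ (E.length + T2.length + Q1.length + P1.length + Q1.length) :=
    fun hl => h.cycLen (by omega) hG [(0, true), (3, true), (5, false), (1, true), (4, true)]
      (by simp [pickArcs]; grind) (by simp [pickArcs]; grind)
  have c4 : 2 ≤ Q1.length → CycLen ℓ (E.length + T2.length + L1.length + P1.length + L1.length) :=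
    fun hl => h.cycLen (by omega) hG [(0, true), (3, true), (7, false), (1, false), (6, true)]
      (by simp [pickArcs]; grind) (by simp [pickArcs]; grind)
  unfold CycLen at *
  omega

lemma ear_opposite_branch_false {ℓ : ℕ} (hℓ : 5 ≤ ℓ) (hG : InGFamily ℓ G) {u1 u2 u3 u4 y : V}
    {E : G.Walk u2 y} {P1 : G.Walk u1 u2} {T1 : G.Walk u3 y} {T2 : G.Walk y u4}
    {Q1 : G.Walk u2 u3} {Q2 : G.Walk u1 u4} {L1 : G.Walk u1 u3} {L2 : G.Walk u2 u4}
    (h : IndFrame [⟨u2, y, E⟩, ⟨u1, u2, P1⟩, ⟨u3, y, T1⟩, ⟨y, u4, T2⟩, ⟨u2, u3, Q1⟩, ⟨u1, u4, Q2⟩,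
      ⟨u1, u3, L1⟩, ⟨u2, u4, L2⟩])
    (hu : [u1, u2, u3, u4, y].Nodup) (hE : 2 ≤ E.length)
    (hP : T1.length + T2.length = P1.length) (hQ : Q2.length = Q1.length)
    (hL : L2.length = L1.length) (hs : P1.length + Q1.length + L1.length = 2 * ℓ + 1)
    (hPl : P1.length ≤ ℓ) (hQl : Q1.length ≤ ℓ) (hLl : L1.length ≤ ℓ) : False := by
  have hp := h.one_le_len
  simp only [List.forall_mem_cons, Arc.len_mk] at hp
  simp only [List.nodup_cons, List.mem_cons, List.not_mem_nil, or_false, not_or] at hu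
  have c1 : CycLen ℓ (E.length + T1.length + Q1.length) :=
    h.cycLen (by omega) hG [(0, true), (2, false), (4, false)] (by simp [pickArcs]; grind)
      (by simp [pickArcs]; grind)
  have c2 : CycLen ℓ (E.length + T2.length + L1.length) :=
    h.cycLen (by omega) hG [(0, true), (3, true), (7, false)] (by simp [pickArcs]; grind)
      (by simp [pickArcs]; grind)
  have c3 : 2 ≤ L1.length → CycLen ℓ (E.length + T2.length + Q1.length + P1.length) :=
    fun hl => h.cycLen (by omega) hG [(0, true), (3, true), (5, false), (1, true)]
      (by simp [pickArcs]; grind) (by simp [pickArcs]; grind)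
  have c4 : 2 ≤ Q1.length → CycLen ℓ (E.length + T1.length + L1.length + P1.length) :=
    fun hl => h.cycLen (by omega) hG [(0, true), (2, false), (6, false), (1, true)]
      (by simp [pickArcs]; grind) (by simp [pickArcs]; grind)
  unfold CycLen at *
  omega

lemma cycLen_arith (ℓ n p a b t1 t2 q l : ℕ) (hℓ : 5 ≤ ℓ)
    (hP : t1 + t2 = p) (hQ : a + b = q) (ha : 1 ≤ a) (hb : 1 ≤ b) (h1 : 1 ≤ t1) (h2 : 1 ≤ t2)
    (hl : 1 ≤ l)
    (hs : p+q+l = 2 * ℓ + 1)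
    (hPl : p ≤ ℓ) (hQl : q ≤ ℓ) (hLl : l ≤ ℓ)
    (c1 : CycLen ℓ (n+t1+b)) (c2 : CycLen ℓ (n+t2+l+a))
    (c3 : 2 ≤ l → CycLen ℓ (n+t2+q+p+a))
    (c4 : 2 ≤ a → 2 ≤ q → 2 ≤ t1 → CycLen ℓ (n+t2+2*l+p+b))
    (c5 : 2 ≤ t2 → 2 ≤ b → 2 ≤ p → CycLen ℓ (n+t1+2*l+q+a))
    (c6 : 2 ≤ t1 → CycLen ℓ (n+t2+q+l+b))
    (c7 : 2 ≤ b → CycLen ℓ (n+t1+l+p+a)) : l = 1 ∧ b = 1 ∧ t1 = 1 := by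
  have hl1 : l = 1 := by
    by_contra hl1
    have d3 := c3 (by omega)
    by_cases hb1 : 2 ≤ b
    · have d7 := c7 hb1
      clear c3 c7 c6 c4
      by_cases h : 2 ≤ t2
      · have d5 := c5 h hb1 (by omega)
        clear c5
        unfold CycLen at *
        omega
      · clear c5
        unfold CycLen at *
        omega
    · clear c3 c7 c5
      by_cases ht : 2 ≤ t1
      · have d6 := c6 ht
        clear c6
        by_cases hq : 2 ≤ a
        · have d4 := c4 hq (by omega) ht
          clear c4
          unfold CycLen at *
          omega
        · clear c4
          unfold CycLen at *
          omega
      · clear c6 c4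
        unfold CycLen at *
        omega
  have hq : q = ℓ := by omega
  have hp : p = ℓ := by omega
  have hb1 : b = 1 := by
    by_contra hb1
    have d7 := c7 (by omega)
    clear c7 c6 c4 c3
    by_cases h : 2 ≤ t2
    · have d5 := c5 h (by omega) (by omega)
      clear c5
      unfold CycLen at *
      omega
    · clear c5
      unfold CycLen at *
      omega
  refine ⟨hl1, hb1, ?_⟩
  by_contra ht
  have d6 := c6 (by omega)
  have d4 := c4 (by omega) (by omega) (by omega)
  clear c3 c4 c5 c6 c7
  unfold CycLen at *
  omega

lemma ear_adjacent_arris {ℓ : ℕ} (hℓ : 5 ≤ ℓ) (hG : InGFamily ℓ G) {u1 u2 u3 u4 x y : V}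
    {E : G.Walk x y} {P1 : G.Walk u1 u2} {A : G.Walk u2 x} {B : G.Walk x u3} {T1 : G.Walk u3 y}
    {T2 : G.Walk y u4} {Q2 : G.Walk u1 u4} {L1 : G.Walk u1 u3} {L2 : G.Walk u2 u4}
    (h : IndFrame [⟨x, y, E⟩, ⟨u1, u2, P1⟩, ⟨u2, x, A⟩, ⟨x, u3, B⟩, ⟨u3, y, T1⟩, ⟨y, u4, T2⟩,
      ⟨u1, u4, Q2⟩, ⟨u1, u3, L1⟩, ⟨u2, u4, L2⟩])
    (hu : [u1, u2, u3, u4, x, y].Nodup) (hE : 2 ≤ E.length)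
    (hP : T1.length + T2.length = P1.length) (hQ : A.length + B.length = Q2.length)
    (hL : L2.length = L1.length) (hs : P1.length + Q2.length + L1.length = 2 * ℓ + 1)
    (hPl : P1.length ≤ ℓ) (hQl : Q2.length ≤ ℓ) (hLl : L1.length ≤ ℓ) :
    L1.length = 1 ∧ B.length = 1 ∧ T1.length = 1 := by
  have hp := h.one_le_len
  simp only [List.forall_mem_cons, Arc.len_mk] at hp
  simp only [List.nodup_cons, List.mem_cons, List.not_mem_nil, or_false, not_or] at hu
  have c1 : CycLen ℓ (E.length + T1.length + B.length) :=
    h.cycLen (by omega) hG [(0, true), (4, false), (3, false)] (by simp [pickArcs]; grind)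
      (by simp [pickArcs]; grind)
  have c2 : CycLen ℓ (E.length + T2.length + L1.length + A.length) :=
    h.cycLen (by omega) hG [(0, true), (5, true), (8, false), (2, true)]
      (by simp [pickArcs]; grind) (by simp [pickArcs]; grind)
  have c3 : 2 ≤ L1.length →
      CycLen ℓ (E.length + T2.length + Q2.length + P1.length + A.length) :=
    fun hl => h.cycLen (by omega) hG [(0, true), (5, true), (6, false), (1, true), (2, true)]
      (by simp [pickArcs]; grind) (by simp [pickArcs]; grind)
  have c4 : 2 ≤ A.length → 2 ≤ Q2.length → 2 ≤ T1.length →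
      CycLen ℓ (E.length + T2.length + 2 * L1.length + P1.length + B.length) :=
    fun _ _ _ => h.cycLen (by omega) hG
      [(0, true), (5, true), (8, false), (1, false), (7, true), (3, false)]
      (by simp [pickArcs]; grind) (by simp [pickArcs]; grind)
  have c5 : 2 ≤ T2.length → 2 ≤ B.length → 2 ≤ P1.length →
      CycLen ℓ (E.length + T1.length + 2 * L1.length + Q2.length + A.length) :=
    fun _ _ _ => h.cycLen (by omega) hG
      [(0, true), (4, false), (7, false), (6, true), (8, false), (2, true)]
      (by simp [pickArcs]; grind) (by simp [pickArcs]; grind)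
  have c6 : 2 ≤ T1.length →
      CycLen ℓ (E.length + T2.length + Q2.length + L1.length + B.length) :=
    fun _ => h.cycLen (by omega) hG [(0, true), (5, true), (6, false), (7, true), (3, false)]
      (by simp [pickArcs]; grind) (by simp [pickArcs]; grind)
  have c7 : 2 ≤ B.length →
      CycLen ℓ (E.length + T1.length + L1.length + P1.length + A.length) :=
    fun _ => h.cycLen (by omega) hG [(0, true), (4, false), (7, false), (1, true), (2, true)]
      (by simp [pickArcs]; grind) (by simp [pickArcs]; grind)
  exact cycLen_arith ℓ E.length P1.length A.length B.length T1.length T2.length Q2.length L1.length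
    hℓ hP hQ (by omega) (by omega) (by omega) (by omega) (by omega) hs hPl hQl hLl c1 c2 c3 c4 c5
    c6 c7

lemma mem_interiorL {a b : V} {p : G.Walk a b} (hp : p.IsPath) {v : V} :
    v ∈ interiorL p ↔ v ∈ p.support ∧ v ≠ a ∧ v ≠ b := by
  have hn := hp.support_nodup
  cases p with
  | nil => simp [interiorL]
  | cons h q =>
    have hq : q.support = q.support.dropLast ++ [b] := by
      have hq := List.dropLast_append_getLast q.support_ne_nil
      rw [q.getLast_support] at hq
      exact hq.symm
    simp only [interiorL, Walk.support_cons, List.tail_cons] at hn ⊢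
    have hm : v ∈ q.support.dropLast ++ [b] ↔ v ∈ q.support.dropLast ∨ v = b := by
      rw [List.mem_append, List.mem_singleton]
    rw [← hq] at hm
    have hb : b ∉ q.support.dropLast := by
      intro hb
      rw [hq] at hn
      exact (List.disjoint_of_nodup_append (List.nodup_cons.1 hn).2) hb (by simp)
    have ha := (List.nodup_cons.1 hn).1
    grind [List.mem_of_mem_dropLast]

/-- Six arcs forming an induced subdivision of `K₄` with odd faces. -/
lemma IndFrame.exists_oddK4 {ℓ : ℕ} (hℓ : 2 ≤ ℓ) (hG : InGFamily ℓ G) {u1 u2 u3 u4 : V}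
    {P1 : G.Walk u1 u2} {P2 : G.Walk u3 u4} {Q1 : G.Walk u2 u3} {Q2 : G.Walk u1 u4}
    {L1 : G.Walk u1 u3} {L2 : G.Walk u2 u4}
    (h : IndFrame [⟨u1, u2, P1⟩, ⟨u3, u4, P2⟩, ⟨u2, u3, Q1⟩, ⟨u1, u4, Q2⟩, ⟨u1, u3, L1⟩,
      ⟨u2, u4, L2⟩])
    (hu : [u1, u2, u3, u4].Nodup)
    (h1 : (P1.length + Q1.length + L1.length) % 2 = 1)
    (h2 : (P1.length + L2.length + Q2.length) % 2 = 1)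
    (h3 : (L1.length + P2.length + Q2.length) % 2 = 1)
    (h4 : (Q1.length + P2.length + L2.length) % 2 = 1) :
    ∃ K : OddK4 G, K.P1.length = P1.length ∧ K.P2.length = P2.length ∧
      K.Q1.length = Q1.length ∧ K.Q2.length = Q2.length ∧ K.L1.length = L1.length ∧
      K.L2.length = L2.length := by
  have hpath := h.path
  have hdisj := h.disj
  simp only [List.forall_mem_cons, List.pairwise_cons] at hpath hdisj
  have hu' := hu
  simp only [List.nodup_cons, List.mem_cons, List.not_mem_nil, or_false, not_or] at hu'
  have int : ∀ {a b : V} (p : G.Walk a b), p.IsPath → ∀ v ∈ interiorL p,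
      v ∈ p.support ∧ v ≠ a ∧ v ≠ b := fun p hp v hv => (mem_interiorL hp).1 hv
  have dj : ∀ {a b c d : V} (p : G.Walk a b) (q : G.Walk c d), p.IsPath → q.IsPath →
      (⟨a, b, p⟩ : Arc G).Disj ⟨c, d, q⟩ → (interiorL p).Disjoint (interiorL q) := by
    intro a b c d p q hp hq hd v hv hw
    have := int p hp v hv
    have := hd v this.1 (int q hq v hw).1
    simp only [Arc.IsEnd] at this
    grind
  have br : ∀ (f : Arc G), f ∈ [(⟨u1, u2, P1⟩ : Arc G), ⟨u3, u4, P2⟩, ⟨u2, u3, Q1⟩, ⟨u1, u4, Q2⟩,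
      ⟨u1, u3, L1⟩, ⟨u2, u4, L2⟩] → ∀ x ∈ interiorL f.w, x ∉ [u1, u2, u3, u4] := by
    intro f hf x hx hxu
    obtain ⟨hxs, hxa, hxb⟩ := int f.w (h.path f hf) x hx
    have : ∃ e ∈ [(⟨u1, u2, P1⟩ : Arc G), ⟨u3, u4, P2⟩, ⟨u2, u3, Q1⟩, ⟨u1, u4, Q2⟩,
      ⟨u1, u3, L1⟩, ⟨u2, u4, L2⟩], e.IsEnd x := by
      simp only [List.exists_mem_cons_iff, Arc.IsEnd]
      simp only [List.mem_cons, List.not_mem_nil, or_false] at hxu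
      tauto
    obtain ⟨e, he, hxe⟩ := this
    rcases h.isEnd_of_isEnd he hf hxe hxs with h | h
    · exact hxa h
    · exact hxb h
  simp only [List.forall_mem_cons] at br
  refine ⟨⟨u1, u2, u3, u4, P1, P2, Q1, Q2, L1, L2, hpath.1, hpath.2.1, hpath.2.2.1, hpath.2.2.2.1,
    hpath.2.2.2.2.1, hpath.2.2.2.2.2.1, hu, ?_, ?_, ?_, ?_, ?_, ?_⟩, rfl, rfl, rfl, rfl, rfl, rfl⟩
  · simp only [List.pairwise_cons, List.forall_mem_cons]
    grind
  · simp only [List.mem_append]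
    grind
  · exact IndFrame.isOddHole hℓ hG (h.pick [(0, true), (2, true), (4, false)] (by decide)
      (by simp [pickArcs, Arc.IsEnd]; grind)) (by simpa using h1)
  · exact IndFrame.isOddHole hℓ hG (h.pick [(0, true), (5, true), (3, false)] (by decide)
      (by simp [pickArcs, Arc.IsEnd]; grind)) (by simpa using h2)
  · exact IndFrame.isOddHole hℓ hG (h.pick [(4, true), (1, true), (3, false)] (by decide)
      (by simp [pickArcs, Arc.IsEnd]; grind)) (by simpa using h3)
  · exact IndFrame.isOddHole hℓ hG (h.pick [(2, true), (1, true), (5, false)] (by decide)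
      (by simp [pickArcs, Arc.IsEnd]; grind)) (by simpa using h4)

end EarLengths

section OppositeEar

variable {G : SimpleGraph V}

lemma cycLen_arith_opposite {ℓ n s1 s2 t1 t2 q l : ℕ} (hℓ : 5 ≤ ℓ)
    (ht1 : 1 ≤ t1) (hq : 1 ≤ q) (hl : 1 ≤ l) (hs2 : 1 ≤ s2) (hP : t1 + t2 = s1 + s2)
    (hs : s1 + s2 + q + l = 2 * ℓ + 1) (hPl : s1 + s2 ≤ ℓ) (hQP : q ≤ s1 + s2) (hLP : l ≤ s1 + s2)
    (hS : s2 ≤ s1) (hodd : (n + s1 + t1 + l) % 2 = 1)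
    (c1 : CycLen ℓ (n + s1 + t1 + l))
    (c3 : CycLen ℓ (n + s2 + t1 + q)) (c4 : CycLen ℓ (n + s2 + t2 + l))
    (c6 : 2 ≤ s1 → 2 ≤ t1 → 2 ≤ l → CycLen ℓ (n + t2 + 2 * q + l + s2)) :
    l = 1 ∧ q = ℓ ∧ n = ℓ ∧ t1 = s2 ∧ t2 = s1 ∧ s1 + s2 = ℓ := by
  have e1 := c1.2 hodd
  have e4 := c4.2 (by omega)
  have hn : n = q := by omega
  have ht : t1 = s2 := by omega
  have hl : l = 1 := by
    by_contra hl
    by_cases h1 : 2 ≤ s1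
    · by_cases h2 : 2 ≤ t1
      · have := (c6 h1 h2 (by omega)).2 (by omega)
        omega
      · have := c3.1
        have := c3.2
        omega
    · omega
  omega

/-- An odd subdivision of `K₄` of smaller difference obtained by rerouting along an ear. -/
lemma exists_oddK4_diff_lt {ℓ : ℕ} (hℓ : 5 ≤ ℓ) (hG : InGFamily ℓ G) {u1 u2 u3 u4 x y : V}
    {E : G.Walk x y} {S1 : G.Walk u1 x} {S2 : G.Walk x u2} {T1 : G.Walk u3 y} {T2 : G.Walk y u4}
    {Q1 : G.Walk u2 u3} {Q2 : G.Walk u1 u4} {L1 : G.Walk u1 u3} {L2 : G.Walk u2 u4}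
    (h : IndFrame [⟨x, y, E⟩, ⟨u1, x, S1⟩, ⟨x, u2, S2⟩, ⟨u3, y, T1⟩, ⟨y, u4, T2⟩, ⟨u2, u3, Q1⟩,
      ⟨u1, u4, Q2⟩, ⟨u1, u3, L1⟩, ⟨u2, u4, L2⟩])
    (hu : [u1, u2, u3, u4, x, y].Nodup) (hl : L1.length = 1) (hl' : L2.length = 1)
    (hq : Q1.length = ℓ) (hq' : Q2.length = ℓ) (hE : E.length = ℓ) (hT1 : T1.length = S2.length)
    (hT2 : T2.length = S1.length) (hpl : S1.length + S2.length = ℓ) (hS : S2.length ≤ S1.length) :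
    ∃ K : OddK4 G, K.longestPair ∧ K.diff < ℓ - 1 := by
  have hp := h.one_le_len
  simp only [List.forall_mem_cons, Arc.len_mk] at hp
  have hu' := hu
  simp only [List.nodup_cons, List.mem_cons, List.not_mem_nil, or_false, not_or] at hu'
  have hm := (h.pick [(6, true), (0, true), (8, false), (2, false), (7, true), (3, true), (1, true),
    (4, false)] (by decide) (by simp [pickArcs]; omega))
  simp only [pickArcs, List.filterMap_cons, List.filterMap_nil, List.getElem?_cons_succ,
    List.getElem?_cons_zero, Option.map_some, Arc.orient_true, Arc.orient_false_mk] at hm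
  have hm1 := (hm.pick [(2, true), (3, true), (0, true), (1, true), (4, true), (5, true), (6, true),
    (7, true)] (by decide) (by simp)).merge (by grind) (by simp [Arc.IsEnd]; grind)
  have hm2 := (hm1.pick [(3, true), (4, true), (0, true), (1, true), (2, true), (5, true),
    (6, true)] (by decide) (by simp)).merge (by grind) (by simp [Arc.IsEnd]; grind)
  have hm3 : IndFrame [⟨u1, u4, Q2⟩, ⟨x, y, E⟩, ⟨u4, x, L2.reverse.append S2.reverse⟩,
      ⟨u1, y, L1.append T1⟩, ⟨u1, x, S1⟩, ⟨u4, y, T2.reverse⟩] :=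
    hm2.pick [(2, true), (3, true), (1, true), (0, true), (4, true), (5, true)]
    (by decide) (by simp)
  obtain ⟨K, h1, h2, h3, h4, h5, h6⟩ := hm3.exists_oddK4 (by omega) hG
    (by simp; grind) (by simp; omega) (by simp; omega) (by simp; omega)
    (by simp; omega)
  simp only [Walk.length_append, Walk.length_reverse] at h1 h2 h3 h4 h5 h6
  refine ⟨K, ?_, ?_⟩
  · unfold OddK4.longestPair
    rw [h1, h2, h3, h4, h5, h6]
    omega
  · unfold OddK4.diff
    rw [h1, h3, h5]
    omega

lemma ear_opposite_arris_aux {ℓ : ℕ} (hℓ : 5 ≤ ℓ) (hG : InGFamily ℓ G) {u1 u2 u3 u4 x y : V}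
    {E : G.Walk x y} {S1 : G.Walk u1 x} {S2 : G.Walk x u2} {T1 : G.Walk u3 y} {T2 : G.Walk y u4}
    {Q1 : G.Walk u2 u3} {Q2 : G.Walk u1 u4} {L1 : G.Walk u1 u3} {L2 : G.Walk u2 u4}
    (h : IndFrame [⟨x, y, E⟩, ⟨u1, x, S1⟩, ⟨x, u2, S2⟩, ⟨u3, y, T1⟩, ⟨y, u4, T2⟩, ⟨u2, u3, Q1⟩,
      ⟨u1, u4, Q2⟩, ⟨u1, u3, L1⟩, ⟨u2, u4, L2⟩])
    (hu : [u1, u2, u3, u4, x, y].Nodup) (hE : 2 ≤ E.length)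
    (hP : T1.length + T2.length = S1.length + S2.length) (hQ : Q2.length = Q1.length)
    (hL : L2.length = L1.length)
    (hs : S1.length + S2.length + Q1.length + L1.length = 2 * ℓ + 1)
    (hPl : S1.length + S2.length ≤ ℓ) (hQP : Q1.length ≤ S1.length + S2.length)
    (hLP : L1.length ≤ S1.length + S2.length) {d : ℕ}
    (hd : d + min Q1.length L1.length = S1.length + S2.length)
    (hmin : ∀ K : OddK4 G, K.longestPair → d ≤ K.diff)
    (hodd : (E.length + S1.length + T1.length + L1.length) % 2 = 1)
    (hS : S2.length ≤ S1.length) : False := by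
  have hp := h.one_le_len
  simp only [List.forall_mem_cons, Arc.len_mk] at hp
  have hu' := hu
  simp only [List.nodup_cons, List.mem_cons, List.not_mem_nil, or_false, not_or] at hu'
  have c1 : CycLen ℓ (E.length + S1.length + T1.length + L1.length) :=
    h.cycLen (by omega) hG [(0, true), (3, false), (7, false), (1, true)] (by simp [pickArcs]; grind)
      (by simp [pickArcs]; grind)
  have c3 : CycLen ℓ (E.length + S2.length + T1.length + Q1.length) :=
    h.cycLen (by omega) hG [(0, true), (3, false), (5, false), (2, false)]
      (by simp [pickArcs]; grind) (by simp [pickArcs]; grind)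
  have c4 : CycLen ℓ (E.length + S2.length + T2.length + L1.length) :=
    h.cycLen (by omega) hG [(0, true), (4, true), (8, false), (2, false)]
      (by simp [pickArcs]; grind) (by simp [pickArcs]; grind)
  have c6 : 2 ≤ S1.length → 2 ≤ T1.length → 2 ≤ L1.length →
      CycLen ℓ (E.length + T2.length + 2 * Q1.length + L1.length + S2.length) :=
    fun _ _ _ => h.cycLen (by omega) hG
      [(0, true), (4, true), (6, false), (7, true), (5, false), (2, false)]
      (by simp [pickArcs]; grind) (by simp [pickArcs]; grind)
  obtain ⟨hl, hq, hE', hT1, hT2, hpl⟩ := cycLen_arith_opposite hℓ (by omega) (by omega) (by omega)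
    (by omega) hP hs hPl hQP hLP hS hodd c1 c3 c4 c6
  obtain ⟨K, hK, hKd⟩ := exists_oddK4_diff_lt hℓ hG h hu hl (by omega) hq (by omega) hE' hT1 hT2 hpl
    hS
  have := hmin K hK
  omega

/-- The setting is symmetric under exchanging the two ends of each of the arrises carrying the ends
of the ear. -/
lemma ear_opposite_arris_false {ℓ : ℕ} (hℓ : 5 ≤ ℓ) (hG : InGFamily ℓ G) {u1 u2 u3 u4 x y : V}
    {E : G.Walk x y} {S1 : G.Walk u1 x} {S2 : G.Walk x u2} {T1 : G.Walk u3 y} {T2 : G.Walk y u4}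
    {Q1 : G.Walk u2 u3} {Q2 : G.Walk u1 u4} {L1 : G.Walk u1 u3} {L2 : G.Walk u2 u4}
    (h : IndFrame [⟨x, y, E⟩, ⟨u1, x, S1⟩, ⟨x, u2, S2⟩, ⟨u3, y, T1⟩, ⟨y, u4, T2⟩, ⟨u2, u3, Q1⟩,
      ⟨u1, u4, Q2⟩, ⟨u1, u3, L1⟩, ⟨u2, u4, L2⟩])
    (hu : [u1, u2, u3, u4, x, y].Nodup) (hE : 2 ≤ E.length)
    (hP : T1.length + T2.length = S1.length + S2.length) (hQ : Q2.length = Q1.length)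
    (hL : L2.length = L1.length)
    (hs : S1.length + S2.length + Q1.length + L1.length = 2 * ℓ + 1)
    (hPl : S1.length + S2.length ≤ ℓ) (hQP : Q1.length ≤ S1.length + S2.length)
    (hLP : L1.length ≤ S1.length + S2.length) {d : ℕ}
    (hd : d + min Q1.length L1.length = S1.length + S2.length)
    (hmin : ∀ K : OddK4 G, K.longestPair → d ≤ K.diff) : False := by
  have hu' := hu
  simp only [List.nodup_cons, List.mem_cons, List.not_mem_nil, or_false, not_or] at hu'
  by_cases hodd : (E.length + S1.length + T1.length + L1.length) % 2 = 1
  · by_cases hS : S2.length ≤ S1.length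
    · exact ear_opposite_arris_aux hℓ hG h hu hE hP hQ hL hs hPl hQP hLP hd hmin hodd hS
    · exact ear_opposite_arris_aux hℓ hG (h.pick [(0, true), (2, false), (1, false), (4, false),
        (3, false), (6, true), (5, true), (8, true), (7, true)] (by decide) (by simp)) (by grind) hE
        (by simp; omega) (by omega) (by omega) (by simp; omega) (by simp; omega) (by simp; omega)
        (by simp; omega) (by simp; omega) hmin (by simp; omega) (by simp; omega)
  · by_cases hS : S2.length ≤ S1.length
    · exact ear_opposite_arris_aux hℓ hG (h.pick [(0, true), (1, true), (2, true), (4, false),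
        (3, false), (8, true), (7, true), (6, true), (5, true)] (by decide) (by simp)) (by grind) hE
        (by simp; omega) (by omega) (by omega) (by simp; omega) (by omega) (by omega)
        (by omega) (by omega) hmin (by simp; omega) (by omega)
    · exact ear_opposite_arris_aux hℓ hG (h.pick [(0, true), (2, false), (1, false), (3, true),
        (4, true), (7, true), (8, true), (5, true), (6, true)] (by decide) (by simp)) (by grind) hE
        (by simp; omega) (by omega) (by omega) (by simp; omega) (by simp; omega) (by simp; omega)
        (by simp; omega) (by simp; omega) hmin (by simp; omega) (by simp; omega)
end OppositeEar

section Arrises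

variable {G : SimpleGraph V} {u1 u2 u3 u4 : V}

/-- The six arrises of a subdivision of `K₄`. -/
abbrev k4Arcs (P1 : G.Walk u1 u2) (P2 : G.Walk u3 u4) (Q1 : G.Walk u2 u3) (Q2 : G.Walk u1 u4)
    (L1 : G.Walk u1 u3) (L2 : G.Walk u2 u4) : List (Arc G) :=
  [⟨u1, u2, P1⟩, ⟨u3, u4, P2⟩, ⟨u2, u3, Q1⟩, ⟨u1, u4, Q2⟩, ⟨u1, u3, L1⟩, ⟨u2, u4, L2⟩]

lemma Frame.opposite_false {ℓ : ℕ} (hℓ : 5 ≤ ℓ) (hG : InGFamily ℓ G)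
    {P1 : G.Walk u1 u2} {P2 : G.Walk u3 u4} {Q1 : G.Walk u2 u3} {Q2 : G.Walk u1 u4}
    {L1 : G.Walk u1 u3} {L2 : G.Walk u2 u4} (h : Frame (k4Arcs P1 P2 Q1 Q2 L1 L2))
    (hu : [u1, u2, u3, u4].Nodup) (hP : P2.length = P1.length) (hQ : Q2.length = Q1.length)
    (hL : L2.length = L1.length) (hs : P1.length + Q1.length + L1.length = 2 * ℓ + 1)
    (hPl : P1.length ≤ ℓ) {v w : V} (hv : v ∈ P1.support) (hw : w ∈ P2.support)
    (hv1 : v ≠ u1) (hv2 : v ≠ u2) (hw3 : w ≠ u3) (hw4 : w ≠ u4) {E : G.Walk v w} (hE : E.IsPath)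
    (hX : ∀ z ∈ E.support, z ≠ v → z ≠ w → z ∉ arcVerts (k4Arcs P1 P2 Q1 Q2 L1 L2))
    (hEl : E.length ≤ 2) : False := by
  have hd := h.disj_of_getElem? (i := 0) (j := 1) rfl rfl (by decide)
  have hvw : v ≠ w := by
    rintro rfl
    rcases (hd v hv hw).1 with h | h
    · exact hv1 h
    · exact hv2 h
  obtain ⟨S1, S2, rfl⟩ := Walk.mem_support_iff_exists_append.1 hv
  obtain ⟨T1, T2, rfl⟩ := Walk.mem_support_iff_exists_append.1 hw
  have h1 : Frame [⟨u1, v, S1⟩, ⟨v, u2, S2⟩, ⟨u3, u4, T1.append T2⟩, ⟨u2, u3, Q1⟩, ⟨u1, u4, Q2⟩,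
    ⟨u1, u3, L1⟩, ⟨u2, u4, L2⟩] := h.split hv1 hv2
  have h2 : Frame [⟨u3, w, T1⟩, ⟨w, u4, T2⟩, ⟨u1, v, S1⟩, ⟨v, u2, S2⟩, ⟨u2, u3, Q1⟩,
    ⟨u1, u4, Q2⟩, ⟨u1, u3, L1⟩, ⟨u2, u4, L2⟩] := (h1.pick [(2, true), (0, true), (1, true),
      (3, true), (4, true), (5, true), (6, true)] (by decide)).split hw3 hw4
  have h3 := h2.cons (p := E) hE hvw (fun z hz hzv hzw hzX => hX z hz hzv hzw (by
    simp only [arcVerts, List.exists_mem_cons_iff, Set.mem_ofPred_eq,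
      Walk.mem_support_append_iff] at hzX ⊢
    tauto)) (by simp [Arc.IsEnd]) (by simp [Arc.IsEnd])
  have hp := h3.one_le_len
  simp only [List.forall_mem_cons, Arc.len_mk] at hp
  simp only [List.nodup_cons, List.mem_cons, List.not_mem_nil, or_false, not_or] at hu
  simp only [Walk.length_append] at hs hP hPl
  have hv3 : v ≠ u3 := by
    rintro rfl
    rcases (hd v hv (by simp)).1 with h | h
    · exact hv1 h
    · exact hv2 h
  have hv4 : v ≠ u4 := by
    rintro rfl
    rcases (hd v hv (by simp)).1 with h | h
    · exact hv1 h
    · exact hv2 h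
  have hw1 : w ≠ u1 := by
    rintro rfl
    rcases (hd w (by simp) hw).2 with h | h
    · exact hw3 h
    · exact hw4 h
  have hw2 : w ≠ u2 := by
    rintro rfl
    rcases (hd w (by simp) hw).2 with h | h
    · exact hw3 h
    · exact hw4 h
  have c1 : 2 * ℓ + 1 ≤ E.length + T1.length + L1.length + S1.length :=
    h3.le_sum hG [(0, true), (1, false), (7, false), (3, true)] (by simp [pickArcs]; grind)
  have c2 : 2 * ℓ + 1 ≤ E.length + T2.length + Q1.length + S1.length :=
    h3.le_sum hG [(0, true), (2, true), (6, false), (3, true)] (by simp [pickArcs]; grind)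
  have c3 : 2 * ℓ + 1 ≤ E.length + T1.length + Q1.length + S2.length :=
    h3.le_sum hG [(0, true), (1, false), (5, false), (4, false)] (by simp [pickArcs]; grind)
  have c4 : 2 * ℓ + 1 ≤ E.length + T2.length + L1.length + S2.length :=
    h3.le_sum hG [(0, true), (2, true), (8, false), (4, false)] (by simp [pickArcs]; grind)
  omega

lemma OddK4.frame (K : OddK4 G) : Frame (k4Arcs K.P1 K.P2 K.Q1 K.Q2 K.L1 K.L2) := by
  have hu := K.hnodup
  simp only [List.nodup_cons, List.mem_cons, List.not_mem_nil, or_false, not_or] at hu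
  have hpath : ∀ e ∈ k4Arcs K.P1 K.P2 K.Q1 K.Q2 K.L1 K.L2, e.w.IsPath := by
    simp [K.hP1, K.hP2, K.hQ1, K.hQ2, K.hL1, K.hL2]
  have hends : ∀ e ∈ k4Arcs K.P1 K.P2 K.Q1 K.Q2 K.L1 K.L2, ∀ v, e.IsEnd v →
      v ∈ [K.u1, K.u2, K.u3, K.u4] := by
    simp only [List.forall_mem_cons, Arc.IsEnd]
    grind
  have hbr : ∀ e ∈ k4Arcs K.P1 K.P2 K.Q1 K.Q2 K.L1 K.L2, ∀ v ∈ interiorL e.w,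
      v ∉ [K.u1, K.u2, K.u3, K.u4] := by
    have := K.hbranch
    simp only [List.mem_append] at this
    simp only [List.forall_mem_cons]
    grind
  refine ⟨hpath, ?_, ?_⟩
  · simp only [List.forall_mem_cons]
    grind
  · have hd : ((k4Arcs K.P1 K.P2 K.Q1 K.Q2 K.L1 K.L2).map fun e => interiorL e.w).Pairwise
      List.Disjoint := K.hdisj
    rw [List.pairwise_map] at hd
    refine hd.imp_of_mem fun {e f} he hf hef v hve hvf => ?_
    have hie : v ∈ interiorL e.w ∨ e.IsEnd v := by
      rw [mem_interiorL (hpath e he), Arc.IsEnd]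
      tauto
    have hif : v ∈ interiorL f.w ∨ f.IsEnd v := by
      rw [mem_interiorL (hpath f hf), Arc.IsEnd]
      tauto
    rcases hie with h1 | h1
    · rcases hif with h2 | h2
      · exact (hef h1 h2).elim
      · exact (hbr e he v h1 (hends f hf v h2)).elim
    · rcases hif with h2 | h2
      · exact (hbr f hf v h2 (hends e he v h1)).elim
      · exact ⟨h1, h2⟩

lemma OddK4.mem_verts (K : OddK4 G) {v : V} :
    v ∈ K.verts ↔ v ∈ arcVerts (k4Arcs K.P1 K.P2 K.Q1 K.Q2 K.L1 K.L2) := by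
  simp [OddK4.verts, OddK4.toSubgraph, arcVerts, or_assoc]

end Arrises

section OddSubdivision

variable {G : SimpleGraph V}

lemma IsOddHole.exists_walk {v : V} {c : G.Walk v v} {a b : V}
    (ha : a ∈ c.support) (hb : b ∈ c.support) :
    ∃ p : G.Walk a b, p.IsPath ∧ (∀ z ∈ p.support, z ∈ c.support) ∧ 2 * p.length ≤ c.length := by
  classical
  have hb' : b ∈ (c.rotate a ha).support := by
    rw [Walk.mem_support_rotate_iff]
    exact hb
  have hsub : ∀ z ∈ (c.rotate a ha).support, z ∈ c.support := fun z hz =>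
    (Walk.mem_support_rotate_iff ..).1 hz
  obtain ⟨p, q, hpq⟩ := Walk.mem_support_iff_exists_append.1 hb'
  have hl : p.length + q.length = c.length := by
    rw [← Walk.length_append, ← hpq, Walk.length_rotate]
  rw [hpq] at hsub
  simp only [Walk.mem_support_append_iff] at hsub
  rcases le_total p.length q.length with h | h
  · refine ⟨p.bypass, p.bypass_isPath,
      fun z hz => hsub z (.inl (p.support_bypass_subset_support hz)), ?_⟩
    have := p.length_bypass_le_length
    omega
  · refine ⟨q.reverse.bypass, q.reverse.bypass_isPath, fun z hz => hsub z (.inr ?_), ?_⟩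
    · simpa using q.reverse.support_bypass_subset_support hz
    · have := q.reverse.length_bypass_le_length
      rw [Walk.length_reverse] at this
      omega

variable (K : OddK4 G)

/-- The arrises of an odd `K₄`-subdivision. -/
abbrev OddK4.arcs : List (Arc G) := k4Arcs K.P1 K.P2 K.Q1 K.Q2 K.L1 K.L2

lemma OddK4.exists_face_or {a b : V} (ha : a ∈ arcVerts K.arcs) (hb : b ∈ arcVerts K.arcs) :
    (∃ (v : V) (c : G.Walk v v), IsOddHole G c ∧ (∀ z ∈ c.support, z ∈ arcVerts K.arcs) ∧
      (∀ s ∈ c.edges, ∃ g ∈ K.arcs, s ∈ g.w.edges) ∧ a ∈ c.support ∧ b ∈ c.support) ∨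
    ∃ i j : ℕ, ((i, j) = (0, 1) ∨ (i, j) = (2, 3) ∨ (i, j) = (4, 5)) ∧
      ∃ e f, K.arcs[i]? = some e ∧ K.arcs[j]? = some f ∧
      ((a ∈ e.w.support ∧ ¬ e.IsEnd a ∧ b ∈ f.w.support ∧ ¬ f.IsEnd b) ∨
        (b ∈ e.w.support ∧ ¬ e.IsEnd b ∧ a ∈ f.w.support ∧ ¬ f.IsEnd a)) := by
  set goal := _ ∨ _
  have f1 : a ∈ K.P1.support ∨ a ∈ K.Q1.support ∨ a ∈ K.L1.support →
      b ∈ K.P1.support ∨ b ∈ K.Q1.support ∨ b ∈ K.L1.support → goal := fun h1 h2 =>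
    .inl ⟨_, _, K.face1, by simp [arcVerts]; grind, by simp; grind, by simp; grind,
      by simp; grind⟩
  have f2 : a ∈ K.P1.support ∨ a ∈ K.L2.support ∨ a ∈ K.Q2.support →
      b ∈ K.P1.support ∨ b ∈ K.L2.support ∨ b ∈ K.Q2.support → goal := fun h1 h2 =>
    .inl ⟨_, _, K.face2, by simp [arcVerts]; grind, by simp; grind, by simp; grind,
      by simp; grind⟩
  have f3 : a ∈ K.L1.support ∨ a ∈ K.P2.support ∨ a ∈ K.Q2.support →
      b ∈ K.L1.support ∨ b ∈ K.P2.support ∨ b ∈ K.Q2.support → goal := fun h1 h2 =>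
    .inl ⟨_, _, K.face3, by simp [arcVerts]; grind, by simp; grind, by simp; grind,
      by simp; grind⟩
  have f4 : a ∈ K.Q1.support ∨ a ∈ K.P2.support ∨ a ∈ K.L2.support →
      b ∈ K.Q1.support ∨ b ∈ K.P2.support ∨ b ∈ K.L2.support → goal := fun h1 h2 =>
    .inl ⟨_, _, K.face4, by simp [arcVerts]; grind, by simp; grind, by simp; grind,
      by simp; grind⟩
  have oP := fun h => (show goal from .inr ⟨0, 1, by simp, _, _, rfl, rfl, h⟩)
  have oQ := fun h => (show goal from .inr ⟨2, 3, by simp, _, _, rfl, rfl, h⟩)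
  have oL := fun h => (show goal from .inr ⟨4, 5, by simp, _, _, rfl, rfl, h⟩)
  clear_value goal
  simp only [Arc.IsEnd, not_or] at oP oQ oL
  have hends : ∀ c : V, (c = K.u1 → c ∈ K.P1.support ∧ c ∈ K.Q2.support ∧ c ∈ K.L1.support) ∧
      (c = K.u2 → c ∈ K.P1.support ∧ c ∈ K.Q1.support ∧ c ∈ K.L2.support) ∧
      (c = K.u3 → c ∈ K.P2.support ∧ c ∈ K.Q1.support ∧ c ∈ K.L1.support) ∧
      (c = K.u4 → c ∈ K.P2.support ∧ c ∈ K.Q2.support ∧ c ∈ K.L2.support) := by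
    intro c
    refine ⟨?_, ?_, ?_, ?_⟩ <;> rintro rfl <;> simp
  have hea := hends a
  have heb := hends b
  clear hends
  simp only [arcVerts, List.exists_mem_cons_iff, Set.mem_ofPred_eq, List.not_mem_nil,
    false_and, exists_false, or_false] at ha hb
  grind

variable {K}

lemma OddK4.length_eq {ℓ : ℕ} (hG : InGFamily ℓ G) :
    K.P2.length = K.P1.length ∧ K.Q2.length = K.Q1.length ∧ K.L2.length = K.L1.length ∧
      K.P1.length + K.Q1.length + K.L1.length = 2 * ℓ + 1 ∧ K.P1.length ≤ ℓ := by
  have h1 := hG.2 _ _ K.face1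
  have h2 := hG.2 _ _ K.face2
  have h3 := hG.2 _ _ K.face3
  have h4 := hG.2 _ _ K.face4
  simp only [Walk.length_append, Walk.length_reverse] at h1 h2 h3 h4
  have hu := K.hnodup
  simp only [List.nodup_cons, List.mem_cons, List.not_mem_nil, or_false, not_or] at hu
  have hp := K.frame.one_le_len
  simp only [List.forall_mem_cons, Arc.len_mk] at hp
  have c : 2 * ℓ + 1 ≤ K.Q1.length + K.L1.length + K.Q2.length + K.L2.length :=
    K.frame.le_sum hG [(2, true), (4, false), (3, true), (5, false)] (by simp [pickArcs]; grind)
  omega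

lemma OddK4.opposite_false {ℓ : ℕ} (hℓ : 5 ≤ ℓ) (hG : InGFamily ℓ G) (hlong : K.longestPair)
    {i j : ℕ} (hij : (i, j) = (0, 1) ∨ (i, j) = (2, 3) ∨ (i, j) = (4, 5)) {e f : Arc G}
    (he : K.arcs[i]? = some e) (hf : K.arcs[j]? = some f) {v w : V} (hv : v ∈ e.w.support)
    (hve : ¬ e.IsEnd v) (hw : w ∈ f.w.support) (hwf : ¬ f.IsEnd w) {E : G.Walk v w}
    (hE : E.IsPath) (hX : ∀ z ∈ E.support, z ≠ v → z ≠ w → z ∉ arcVerts K.arcs)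
    (hEl : E.length ≤ 2) : False := by
  obtain ⟨hP, hQ, hL, hs, hPl⟩ := OddK4.length_eq hG
  have hl := hlong
  unfold OddK4.longestPair at hl
  have hu := K.hnodup
  rw [Arc.IsEnd, not_or] at hve hwf
  rcases hij with hij | hij | hij <;> obtain ⟨rfl, rfl⟩ := Prod.mk.inj hij <;>
    obtain rfl := Option.some.inj he <;> obtain rfl := Option.some.inj hf
  · exact K.frame.opposite_false hℓ hG hu hP hQ hL hs hPl hv hw hve.1 hve.2 hwf.1 hwf.2 hE hX hEl
  · have h1 : Frame (k4Arcs K.Q1 K.Q2 K.L1.reverse K.L2 K.P1.reverse K.P2) :=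
      K.frame.pick [(2, true), (3, true), (4, false), (5, true), (0, false), (1, true)]
        (by decide)
    refine h1.opposite_false hℓ hG ?_ hQ (by simpa) (by simpa) (by simp; omega) (by omega)
      hv hw hve.1 hve.2 hwf.1 hwf.2 hE (fun z hz h h' hzX => hX z hz h h' ?_) hEl
    · simp only [List.nodup_cons, List.mem_cons] at hu ⊢
      grind
    · simp [arcVerts] at hzX ⊢
      grind
  · have h1 : Frame (k4Arcs K.L1 K.L2 K.Q1.reverse K.Q2 K.P1 K.P2) :=
      K.frame.pick [(4, true), (5, true), (2, false), (3, true), (0, true), (1, true)]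
        (by decide)
    refine h1.opposite_false hℓ hG ?_ hL (by simpa) (by simpa) (by simp; omega) (by omega)
      hv hw hve.1 hve.2 hwf.1 hwf.2 hE (fun z hz h h' hzX => hX z hz h h' ?_) hEl
    · simp only [List.nodup_cons, List.mem_cons] at hu ⊢
      grind
    · simp [arcVerts] at hzX ⊢
      grind

lemma OddK4.indFrame {ℓ : ℕ} (hℓ : 5 ≤ ℓ) (hG : InGFamily ℓ G) (hlong : K.longestPair) :
    IndFrame K.arcs where
  toFrame := K.frame
  ind e he f hf v hv w hw hvw := by
    rcases K.exists_face_or ⟨e, he, hv⟩ ⟨f, hf, hw⟩ with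
      ⟨x, c, hc, -, hce, hvc, hwc⟩ | ⟨i, j, hij, g, g', hg, hg', h | h⟩
    · exact hce _ (hc.1.2.2 v hvc w hwc hvw)
    · exact (OddK4.opposite_false hℓ hG hlong hij hg hg' h.1 h.2.1 h.2.2.1 h.2.2.2
        (E := hvw.toWalk) (by simpa using hvw.ne)
        (fun z hz h1 h2 => by simp at hz; tauto) (by simp)).elim
    · exact (OddK4.opposite_false hℓ hG hlong hij hg hg' h.1 h.2.1 h.2.2.1 h.2.2.2
        (E := hvw.symm.toWalk) (by simpa using hvw.ne')
        (fun z hz h1 h2 => by simp at hz; tauto) (by simp)).elim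

lemma OddK4.eq_of_adj {ℓ : ℕ} (hℓ : 5 ≤ ℓ) (hG : InGFamily ℓ G) (hlong : K.longestPair)
    {v a b : V} (hv : v ∉ arcVerts K.arcs) (ha : a ∈ arcVerts K.arcs) (hb : b ∈ arcVerts K.arcs)
    (hva : G.Adj v a) (hvb : G.Adj v b) : a = b := by
  by_contra hab
  have hE : ∀ {c d : V} (hc : G.Adj v c) (hd : G.Adj v d), c ≠ d →
      (Walk.cons hc.symm hd.toWalk).IsPath := by
    intro c d hc hd hcd
    simp [Walk.cons_isPath_iff, hd.ne, hcd, hc.ne']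
  rcases K.exists_face_or ha hb with
    ⟨x, c, hc, hcX, hce, hvc, hwc⟩ | ⟨i, j, hij, g, g', hg, hg', h | h⟩
  · obtain ⟨p, hp, hpc, hpl⟩ := IsOddHole.exists_walk hvc hwc
    have := hG.le_add_length hp (hE hva hvb hab) (by
      rintro rfl
      exact hv (hcX v (hpc v (by simp))))
    rw [hG.2 _ _ hc] at hpl
    simp at this
    omega
  · exact (OddK4.opposite_false hℓ hG hlong hij hg hg' h.1 h.2.1 h.2.2.1 h.2.2.2 (hE hva hvb hab)
      (fun z hz h1 h2 => by simp at hz; grind) (by simp)).elim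
  · exact (OddK4.opposite_false hℓ hG hlong hij hg hg' h.1 h.2.1 h.2.2.1 h.2.2.2
      (hE hvb hva (Ne.symm hab)) (fun z hz h1 h2 => by simp at hz; grind) (by simp)).elim

end OddSubdivision

section Configurations

variable {G : SimpleGraph V} {ℓ : ℕ} {u1 u2 u3 u4 : V}

/-- The arrises of an induced odd `K₄`-subdivision of least difference in a graph of `𝒢ℓ`. -/
structure Config (ℓ : ℕ) (P1 : G.Walk u1 u2) (P2 : G.Walk u3 u4) (Q1 : G.Walk u2 u3)
    (Q2 : G.Walk u1 u4) (L1 : G.Walk u1 u3) (L2 : G.Walk u2 u4) : Prop where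
  frame : IndFrame (k4Arcs P1 P2 Q1 Q2 L1 L2)
  nodup : [u1, u2, u3, u4].Nodup
  hP : P2.length = P1.length
  hQ : Q2.length = Q1.length
  hL : L2.length = L1.length
  hs : P1.length + Q1.length + L1.length = 2 * ℓ + 1
  hPl : P1.length ≤ ℓ
  hQP : Q1.length ≤ P1.length
  hLP : L1.length ≤ P1.length
  hmin : ∀ K : OddK4 G, K.longestPair → P1.length - min Q1.length L1.length ≤ K.diff
  eq_of_adj : ∀ v ∉ arcVerts (k4Arcs P1 P2 Q1 Q2 L1 L2),
    ∀ a ∈ arcVerts (k4Arcs P1 P2 Q1 Q2 L1 L2), ∀ b ∈ arcVerts (k4Arcs P1 P2 Q1 Q2 L1 L2),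
    G.Adj v a → G.Adj v b → a = b

lemma OddK4.toConfig {K : OddK4 G} (hℓ : 5 ≤ ℓ) (hG : InGFamily ℓ G) (hlong : K.longestPair)
    (hmin : ∀ K' : OddK4 G, K'.longestPair → K.diff ≤ K'.diff) :
    Config ℓ K.P1 K.P2 K.Q1 K.Q2 K.L1 K.L2 := by
  obtain ⟨hP, hQ, hL, hs, hPl⟩ := OddK4.length_eq (K := K) hG
  exact ⟨OddK4.indFrame hℓ hG hlong, K.hnodup, hP, hQ, hL, hs, hPl, hlong.1, hlong.2.2.1, hmin,
    fun v hv a ha b hb => OddK4.eq_of_adj hℓ hG hlong hv ha hb⟩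

namespace Config

variable {P1 : G.Walk u1 u2} {P2 : G.Walk u3 u4} {Q1 : G.Walk u2 u3} {Q2 : G.Walk u1 u4}
  {L1 : G.Walk u1 u3} {L2 : G.Walk u2 u4}

lemma arcVerts_swap12 : arcVerts (k4Arcs P1.reverse P2 L1 L2 Q1 Q2) =
    arcVerts (k4Arcs P1 P2 Q1 Q2 L1 L2) := by
  ext v
  simp [arcVerts]
  tauto

lemma swap12 (h : Config ℓ P1 P2 Q1 Q2 L1 L2) : Config ℓ P1.reverse P2 L1 L2 Q1 Q2 where
  frame := h.frame.pick [(0, false), (1, true), (4, true), (5, true), (2, true), (3, true)]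
    (by decide) (by simp)
  nodup := by
    have := h.nodup
    simp only [List.nodup_cons, List.mem_cons] at this ⊢
    grind
  hP := by simpa using h.hP
  hQ := h.hL
  hL := h.hQ
  hs := by have := h.hs; simp; omega
  hPl := by simpa using h.hPl
  hQP := by simpa using h.hLP
  hLP := by simpa using h.hQP
  hmin := by simpa [min_comm] using h.hmin
  eq_of_adj := by simpa only [arcVerts_swap12] using h.eq_of_adj

lemma arcVerts_swap : arcVerts (k4Arcs P2 P1 Q2.reverse Q1.reverse L1.reverse L2.reverse) =
    arcVerts (k4Arcs P1 P2 Q1 Q2 L1 L2) := by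
  ext v
  simp [arcVerts]
  tauto

lemma swap (h : Config ℓ P1 P2 Q1 Q2 L1 L2) :
    Config ℓ P2 P1 Q2.reverse Q1.reverse L1.reverse L2.reverse where
  frame := h.frame.pick [(1, true), (0, true), (3, false), (2, false), (4, false), (5, false)]
    (by decide) (by simp)
  nodup := by
    have := h.nodup
    simp only [List.nodup_cons, List.mem_cons] at this ⊢
    grind
  hP := h.hP.symm
  hQ := by simpa using h.hQ.symm
  hL := by simpa using h.hL
  hs := by have := h.hs; have := h.hP; have := h.hQ; simp; omega
  hPl := h.hP ▸ h.hPl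
  hQP := by simpa [h.hP, h.hQ] using h.hQP
  hLP := by simpa [h.hP] using h.hLP
  hmin := by simpa [h.hP, h.hQ] using h.hmin
  eq_of_adj := by simpa only [arcVerts_swap] using h.eq_of_adj

lemma arcVerts_swap34 : arcVerts (k4Arcs P1 P2.reverse L2 L1 Q2 Q1) =
    arcVerts (k4Arcs P1 P2 Q1 Q2 L1 L2) := by
  ext v
  simp [arcVerts]
  tauto

lemma swap34 (h : Config ℓ P1 P2 Q1 Q2 L1 L2) : Config ℓ P1 P2.reverse L2 L1 Q2 Q1 where
  frame := h.frame.pick [(0, true), (1, false), (5, true), (4, true), (3, true), (2, true)]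
    (by decide) (by simp)
  nodup := by
    have := h.nodup
    simp only [List.nodup_cons, List.mem_cons] at this ⊢
    grind
  hP := by simpa using h.hP
  hQ := h.hL.symm
  hL := h.hQ.symm
  hs := by have := h.hs; have := h.hL; have := h.hQ; omega
  hPl := h.hPl
  hQP := h.hL ▸ h.hLP
  hLP := h.hQ ▸ h.hQP
  hmin := by simpa [min_comm, h.hL, h.hQ] using h.hmin
  eq_of_adj := by simpa only [arcVerts_swap34] using h.eq_of_adj

lemma arcVerts_swapPQ : arcVerts (k4Arcs Q2 Q1.reverse P2.reverse P1 L1 L2.reverse) =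
    arcVerts (k4Arcs P1 P2 Q1 Q2 L1 L2) := by
  ext v
  simp [arcVerts]
  tauto

lemma swapPQ (h : Config ℓ P1 P2 Q1 Q2 L1 L2) (hPQ : P1.length = Q1.length) :
    Config ℓ Q2 Q1.reverse P2.reverse P1 L1 L2.reverse where
  frame := h.frame.pick [(3, true), (2, false), (1, false), (0, true), (4, true), (5, false)]
    (by decide) (by simp)
  nodup := by
    have := h.nodup
    simp only [List.nodup_cons, List.mem_cons] at this ⊢
    grind
  hP := by simpa using h.hQ.symm
  hQ := by simpa using h.hP.symm
  hL := by simpa using h.hL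
  hs := by have := h.hs; have := h.hP; have := h.hQ; simp; omega
  hPl := by have := h.hPl; have := h.hP; have := h.hQ; omega
  hQP := by have := h.hPl; have := h.hP; have := h.hQ; simp; omega
  hLP := by have := h.hLP; have := h.hP; have := h.hQ; omega
  hmin := by simpa [hPQ, h.hP, h.hQ] using h.hmin
  eq_of_adj := by simpa only [arcVerts_swapPQ] using h.eq_of_adj

end Config
end Configurations

section Ears

namespace Config

variable {G : SimpleGraph V} {ℓ : ℕ} {u1 u2 u3 u4 : V}
  {P1 : G.Walk u1 u2} {P2 : G.Walk u3 u4} {Q1 : G.Walk u2 u3} {Q2 : G.Walk u1 u4}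
  {L1 : G.Walk u1 u3} {L2 : G.Walk u2 u4}

lemma notMem_end (h : Config ℓ P1 P2 Q1 Q2 L1 L2) {y : V} (hy : y ∈ P2.support) (hy3 : y ≠ u3)
    (hy4 : y ≠ u4) : y ≠ u1 ∧ y ≠ u2 := by
  have hd := h.frame.toFrame.disj_of_getElem? (i := 0) (j := 1) rfl rfl (by decide)
  constructor <;> rintro rfl
  · rcases (hd y (by simp) hy).2 with h | h
    · exact hy3 h
    · exact hy4 h
  · rcases (hd y (by simp) hy).2 with h | h
    · exact hy3 h
    · exact hy4 h

/-- Subdividing the second arris. -/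
lemma frame_split {y : V} {T1 : G.Walk u3 y} {T2 : G.Walk y u4}
    (h : Config ℓ P1 (T1.append T2) Q1 Q2 L1 L2) (hy3 : y ≠ u3) (hy4 : y ≠ u4) :
    IndFrame [⟨u3, y, T1⟩, ⟨y, u4, T2⟩, ⟨u1, u2, P1⟩, ⟨u2, u3, Q1⟩, ⟨u1, u4, Q2⟩,
      ⟨u1, u3, L1⟩, ⟨u2, u4, L2⟩] := by
  have h1 : IndFrame [⟨u3, u4, T1.append T2⟩, ⟨u1, u2, P1⟩, ⟨u2, u3, Q1⟩, ⟨u1, u4, Q2⟩,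
      ⟨u1, u3, L1⟩, ⟨u2, u4, L2⟩] :=
    h.frame.pick [(1, true), (0, true), (2, true), (3, true), (4, true), (5, true)]
      (by decide) (by simp)
  exact h1.split hy3 hy4

lemma adj_of_ear_u3 (h : Config ℓ P1 P2 Q1 Q2 L1 L2) (hℓ : 5 ≤ ℓ) (hG : InGFamily ℓ G) {y : V}
    (hy : y ∈ P2.support) (hy3 : y ≠ u3) (hy4 : y ≠ u4) {E : G.Walk u3 y}
    (hE : Ear (arcVerts (k4Arcs P1 P2 Q1 Q2 L1 L2)) E) : G.Adj u3 y := by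
  have hy12 := h.notMem_end hy hy3 hy4
  obtain ⟨T1, T2, rfl⟩ := Walk.mem_support_iff_exists_append.1 hy
  have h1 := h.frame_split hy3 hy4
  by_contra hadj
  have hT : 2 ≤ T1.length := by
    have h0 : T1.length ≠ 0 := fun h0 => hy3 (Walk.eq_of_length_eq_zero h0).symm
    have h1 : T1.length ≠ 1 := fun h1 => hadj (Walk.adj_of_length_eq_one h1)
    omega
  have h2 : IndFrame [⟨u1, u2, P1⟩, ⟨u3, y, T1⟩, ⟨y, u4, T2⟩, ⟨u2, u3, Q1⟩, ⟨u1, u4, Q2⟩,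
      ⟨u1, u3, L1⟩, ⟨u2, u4, L2⟩] :=
    h1.pick [(2, true), (0, true), (1, true), (3, true), (4, true), (5, true), (6, true)]
      (by decide) (by simp)
  have h3 := h2.addEar (hE.mono (by intro v; simp [arcVerts]; tauto)) (by simp [Arc.IsEnd])
    (by simp [Arc.IsEnd])
  have hu := h.nodup
  have hP := h.hP
  rw [Walk.length_append] at hP
  refine ear_branch_false hℓ hG h3 ?_ hE.two_le hT hP h.hQ h.hL h.hs h.hPl
    (h.hQP.trans h.hPl) (h.hLP.trans h.hPl)
  simp only [List.nodup_cons, List.mem_cons] at hu ⊢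
  grind

lemma ear_u2_false (h : Config ℓ P1 P2 Q1 Q2 L1 L2) (hℓ : 5 ≤ ℓ) (hG : InGFamily ℓ G) {y : V}
    (hy : y ∈ P2.support) (hy3 : y ≠ u3) (hy4 : y ≠ u4) {E : G.Walk u2 y}
    (hE : Ear (arcVerts (k4Arcs P1 P2 Q1 Q2 L1 L2)) E) : False := by
  have hy12 := h.notMem_end hy hy3 hy4
  obtain ⟨T1, T2, rfl⟩ := Walk.mem_support_iff_exists_append.1 hy
  have h1 := h.frame_split hy3 hy4
  have h2 : IndFrame [⟨u1, u2, P1⟩, ⟨u3, y, T1⟩, ⟨y, u4, T2⟩, ⟨u2, u3, Q1⟩, ⟨u1, u4, Q2⟩,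
      ⟨u1, u3, L1⟩, ⟨u2, u4, L2⟩] :=
    h1.pick [(2, true), (0, true), (1, true), (3, true), (4, true), (5, true), (6, true)]
      (by decide) (by simp)
  have h3 := h2.addEar (hE.mono (by intro v; simp [arcVerts]; tauto)) (by simp [Arc.IsEnd])
    (by simp [Arc.IsEnd])
  have hu := h.nodup
  have hP := h.hP
  rw [Walk.length_append] at hP
  refine ear_opposite_branch_false hℓ hG h3 ?_ hE.two_le hP h.hQ h.hL h.hs h.hPl
    (h.hQP.trans h.hPl) (h.hLP.trans h.hPl)
  simp only [List.nodup_cons, List.mem_cons] at hu ⊢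
  grind

lemma ear_P1_false (h : Config ℓ P1 P2 Q1 Q2 L1 L2) (hℓ : 5 ≤ ℓ) (hG : InGFamily ℓ G) {x y : V}
    (hy : y ∈ P2.support) (hy3 : y ≠ u3) (hy4 : y ≠ u4) (hx : x ∈ P1.support) (hx1 : x ≠ u1)
    (hx2 : x ≠ u2) {E : G.Walk x y} (hE : Ear (arcVerts (k4Arcs P1 P2 Q1 Q2 L1 L2)) E) :
    False := by
  have hy12 := h.notMem_end hy hy3 hy4
  have hx34 := h.swap.notMem_end hx hx1 hx2
  obtain ⟨T1, T2, rfl⟩ := Walk.mem_support_iff_exists_append.1 hy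
  have h1 := h.frame_split hy3 hy4
  obtain ⟨S1, S2, rfl⟩ := Walk.mem_support_iff_exists_append.1 hx
  have h2 : IndFrame [⟨u1, u2, S1.append S2⟩, ⟨u3, y, T1⟩, ⟨y, u4, T2⟩, ⟨u2, u3, Q1⟩,
      ⟨u1, u4, Q2⟩, ⟨u1, u3, L1⟩, ⟨u2, u4, L2⟩] :=
    h1.pick [(2, true), (0, true), (1, true), (3, true), (4, true), (5, true), (6, true)]
      (by decide) (by simp)
  have h3 := (h2.split hx1 hx2).addEar (hE.mono (by intro v; simp [arcVerts]; tauto))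
    (by simp [Arc.IsEnd]) (by simp [Arc.IsEnd])
  have hu := h.nodup
  have hxy := hE.ne
  have hP := h.hP
  have hs := h.hs
  have hPl := h.hPl
  have hQP := h.hQP
  have hLP := h.hLP
  have hm := h.hmin
  rw [Walk.length_append] at hP hs hPl hQP hLP hm
  rw [Walk.length_append] at hP
  refine ear_opposite_arris_false hℓ hG h3 ?_ hE.two_le hP h.hQ h.hL hs hPl hQP hLP ?_ hm
  · simp only [List.nodup_cons, List.mem_cons] at hu ⊢
    grind
  · omega

lemma of_ear_Q1 (h : Config ℓ P1 P2 Q1 Q2 L1 L2) (hℓ : 5 ≤ ℓ) (hG : InGFamily ℓ G) {x y : V}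
    (hy : y ∈ P2.support) (hy3 : y ≠ u3) (hy4 : y ≠ u4) (hx : x ∈ Q1.support) (hx2 : x ≠ u2)
    (hx3 : x ≠ u3) {E : G.Walk x y} (hE : Ear (arcVerts (k4Arcs P1 P2 Q1 Q2 L1 L2)) E) :
    L1.length = 1 ∧ G.Adj x u3 ∧ G.Adj u3 y := by
  have hy12 := h.notMem_end hy hy3 hy4
  have hx14 : x ≠ u1 ∧ x ≠ u4 := by
    have hd := h.frame.toFrame.disj_of_getElem? (i := 2) (j := 3) rfl rfl (by decide)
    constructor <;> rintro rfl
    · rcases (hd x hx (by simp)).1 with h | h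
      · exact hx2 h
      · exact hx3 h
    · rcases (hd x hx (by simp)).1 with h | h
      · exact hx2 h
      · exact hx3 h
  obtain ⟨T1, T2, rfl⟩ := Walk.mem_support_iff_exists_append.1 hy
  have h1 := h.frame_split hy3 hy4
  obtain ⟨A, B, rfl⟩ := Walk.mem_support_iff_exists_append.1 hx
  have h2 : IndFrame [⟨u2, u3, A.append B⟩, ⟨u1, u2, P1⟩, ⟨u3, y, T1⟩, ⟨y, u4, T2⟩,
      ⟨u1, u4, Q2⟩, ⟨u1, u3, L1⟩, ⟨u2, u4, L2⟩] :=
    h1.pick [(3, true), (2, true), (0, true), (1, true), (4, true), (5, true), (6, true)]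
      (by decide) (by simp)
  have h3 : IndFrame [⟨u2, x, A⟩, ⟨x, u3, B⟩, ⟨u1, u2, P1⟩, ⟨u3, y, T1⟩, ⟨y, u4, T2⟩,
      ⟨u1, u4, Q2⟩, ⟨u1, u3, L1⟩, ⟨u2, u4, L2⟩] := h2.split hx2 hx3
  have h4 : IndFrame [⟨u1, u2, P1⟩, ⟨u2, x, A⟩, ⟨x, u3, B⟩, ⟨u3, y, T1⟩, ⟨y, u4, T2⟩,
      ⟨u1, u4, Q2⟩, ⟨u1, u3, L1⟩, ⟨u2, u4, L2⟩] :=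
    h3.pick [(2, true), (0, true), (1, true), (3, true), (4, true), (5, true), (6, true),
      (7, true)] (by decide) (by simp)
  have h5 := h4.addEar (hE.mono (by intro v; simp [arcVerts]; tauto))
    (by simp [Arc.IsEnd]) (by simp [Arc.IsEnd])
  have hu := h.nodup
  have hxy := hE.ne
  have hP := h.hP
  have hs := h.hs
  have hQ := h.hQ
  have hPl := h.hPl
  have hQP := h.hQP
  rw [Walk.length_append] at hs hQP hP hQ
  have key := ear_adjacent_arris hℓ hG h5 (by
    simp only [List.nodup_cons, List.mem_cons] at hu ⊢
    grind) hE.two_le hP hQ.symm h.hL (by omega) hPl (by omega) (h.hLP.trans h.hPl)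
  exact ⟨key.1, Walk.adj_of_length_eq_one key.2.1, Walk.adj_of_length_eq_one key.2.2⟩

end Config
end Ears

section Cut

variable {G : SimpleGraph V}

/-- A shortest path inside `A` from `S` to `T` is induced and meets `S` and `T` only in its ends. -/
lemma exists_shortest_path {A S T : Set V} {a b : V} (w : G.Walk a b) (ha : a ∈ S) (hb : b ∈ T)
    (hw : ∀ v ∈ w.support, v ∈ A) :
    ∃ (s t : V) (p : G.Walk s t), p.IsPath ∧ (∀ v ∈ p.support, v ∈ A) ∧ s ∈ S ∧ t ∈ T ∧
      (∀ v ∈ p.support, v ∈ S → v = s) ∧ (∀ v ∈ p.support, v ∈ T → v = t) ∧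
      ∀ u ∈ p.support, ∀ v ∈ p.support, G.Adj u v → s(u, v) ∈ p.edges := by
  classical
  have hex : ∃ n, ∃ (s t : V) (p : G.Walk s t), s ∈ S ∧ t ∈ T ∧ (∀ v ∈ p.support, v ∈ A) ∧
      p.length = n := ⟨_, a, b, w, ha, hb, hw, rfl⟩
  obtain ⟨s, t, p, hs, ht, hp, hl⟩ := Nat.find_spec hex
  have hmin : ∀ (s t : V) (q : G.Walk s t), s ∈ S → t ∈ T → (∀ v ∈ q.support, v ∈ A) →
      p.length ≤ q.length := fun s t q hs ht hq =>
    hl ▸ Nat.find_min' hex ⟨s, t, q, hs, ht, hq, rfl⟩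
  refine ⟨s, t, p, ?_, hp, hs, ht, ?_, ?_, ?_⟩
  · have h1 := hmin _ _ p.bypass hs ht fun v hv => hp v (p.support_bypass_subset_support hv)
    rw [← p.bypass_eq_self_of_length_le_length_bypass h1]
    exact p.bypass_isPath
  · intro v hv hvS
    obtain ⟨p1, p2, rfl⟩ := Walk.mem_support_iff_exists_append.1 hv
    have h1 := hmin _ _ p2 hvS ht fun v hv => hp v (by simp [hv])
    rw [Walk.length_append] at h1
    exact (Walk.eq_of_length_eq_zero (p := p1) (by omega)).symm
  · intro v hv hvT
    obtain ⟨p1, p2, rfl⟩ := Walk.mem_support_iff_exists_append.1 hv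
    have h1 := hmin _ _ p1 hs hvT fun v hv => hp v (by simp [hv])
    rw [Walk.length_append] at h1
    exact Walk.eq_of_length_eq_zero (p := p2) (by omega)
  · have key : ∀ {u v : V} {p1 : G.Walk s u} {p2 : G.Walk u v} {p3 : G.Walk v t},
        p = p1.append (p2.append p3) → G.Adj u v → s(u, v) ∈ p.edges := by
      rintro u v p1 p2 p3 rfl huv
      have h1 := hmin _ _ (p1.append (Walk.cons huv p3)) hs ht fun v hv => hp v (by
        simp at hv ⊢
        rcases hv with hv | rfl | hv <;> simp [*])
      simp only [Walk.length_append, Walk.length_cons] at h1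
      cases p2 with
      | nil => exact (huv.ne rfl).elim
      | cons hadj q =>
        rw [Walk.length_cons] at h1
        obtain rfl := Walk.eq_of_length_eq_zero (p := q) (by omega)
        simp
    intro u hu v hv huv
    obtain ⟨p1, p2, hpp⟩ := Walk.mem_support_iff_exists_append.1 hu
    rw [hpp, Walk.mem_support_append_iff] at hv
    rcases hv with hv | hv
    · obtain ⟨p3, p4, rfl⟩ := Walk.mem_support_iff_exists_append.1 hv
      rw [Sym2.eq_swap]
      exact key (hpp.trans (Walk.append_assoc ..).symm) huv.symm
    · obtain ⟨p3, p4, rfl⟩ := Walk.mem_support_iff_exists_append.1 hv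
      exact key hpp huv

/-- `f` restricted to `A` is a proper colouring. -/
def ProperOn (G : SimpleGraph V) (A : Set V) (f : V → Fin 3) : Prop :=
  ∀ u ∈ A, ∀ v ∈ A, G.Adj u v → f u ≠ f v

lemma VertexCritical.exists_properOn (hc : VertexCritical 4 G) (v : V) :
    ∃ f, ProperOn G {v}ᶜ f := by
  classical
  have h1 : (G.induce ({v}ᶜ : Set V)).chromaticNumber ≤ (3 : ℕ) :=
    Order.le_of_lt_add_one (hc.2 v)
  obtain ⟨c⟩ := chromaticNumber_le_iff_colorable.1 h1
  refine ⟨fun u => if h : u ∈ ({v}ᶜ : Set V) then c ⟨u, h⟩ else 0, fun u hu w hw huw => ?_⟩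
  simp only [hu, hw, dite_true]
  exact c.valid huw

lemma VertexCritical.not_properOn (hc : VertexCritical 4 G) (f : V → Fin 3) :
    ¬ ProperOn G Set.univ f := by
  intro hf
  have h1 : G.chromaticNumber ≤ (3 : ℕ) := chromaticNumber_le_iff_colorable.2
    ⟨Coloring.mk f fun {u v} huv => hf u trivial v trivial huv⟩
  rw [hc.1] at h1
  exact absurd h1 (by decide)

/-- Either `a` and `c` are joined by an induced path whose vertices have colours different from
that of `b`, or the colours of `c` can be exchanged by a Kempe change not affecting `a`, `b`. -/
lemma ProperOn.kempe {A : Set V} {f : V → Fin 3} (hf : ProperOn G A f) {a b c : V} (ha : a ∈ A)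
    (hb : b ∈ A) (hc : c ∈ A) (hab : G.Adj a b) (hbc : G.Adj b c) :
    (∃ p : G.Walk a c, p.IsPath ∧ (∀ v ∈ p.support, v ∈ A ∧ f v ≠ f b) ∧
      (∀ u ∈ p.support, ∀ v ∈ p.support, G.Adj u v → s(u, v) ∈ p.edges)) ∨
    ∃ g, ProperOn G A g ∧ g a = f a ∧ g b = f b ∧ (g a = g c ↔ f a ≠ f c) := by
  classical
  by_cases h : ∃ w : G.Walk a c, ∀ v ∈ w.support, v ∈ A ∧ f v ≠ f b
  · obtain ⟨w, hw⟩ := h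
    obtain ⟨s, t, p, hp, hpA, rfl, rfl, -, -, hi⟩ :=
      exists_shortest_path (A := {v | v ∈ A ∧ f v ≠ f b}) (S := {a}) (T := {c}) w rfl rfl hw
    exact .inl ⟨p, hp, hpA, hi⟩
  · right
    have hfa := hf a ha b hb hab
    have hfc := hf b hb c hc hbc
    set B : Set V := {v | ∃ w : G.Walk c v, ∀ u ∈ w.support, u ∈ A ∧ f u ≠ f b} with hB
    have hBA : ∀ v ∈ B, v ∈ A ∧ f v ≠ f b := fun v ⟨w, hw⟩ => hw v (by simp)
    have hcB : c ∈ B := ⟨.nil, by simpa using ⟨hc, hfc.symm⟩⟩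
    have haB : a ∉ B := fun ⟨w, hw⟩ => h ⟨w.reverse, by simpa using hw⟩
    have hbB : b ∉ B := fun hb => (hBA b hb).2 rfl
    have hcl : ∀ u ∈ B, ∀ v ∈ A, G.Adj u v → f v ≠ f b → v ∈ B := by
      rintro u ⟨w, hw⟩ v hv huv hvb
      refine ⟨w.concat huv, fun z hz => ?_⟩
      rw [Walk.support_concat, List.mem_append, List.mem_singleton] at hz
      rcases hz with hz | rfl
      · exact hw z hz
      · exact ⟨hv, hvb⟩
    -- the colour other than `f b` and `k`
    have hthird : ∃ τ : Fin 3 → Fin 3, ∀ k, k ≠ f b → τ k ≠ k ∧ τ k ≠ f b ∧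
        ∀ j, j ≠ f b → j ≠ k → τ k = j := by
      generalize f b = m
      refine ⟨fun k => -(m + k), ?_⟩
      revert m
      decide
    obtain ⟨τ, hτ⟩ := hthird
    have hτinj : ∀ j k, j ≠ f b → k ≠ f b → j ≠ k → τ j ≠ τ k := by
      intro j k hj hk hjk h
      have h1 := (hτ j hj).2.2 k hk hjk.symm
      exact (hτ k hk).1 (h ▸ h1)
    refine ⟨fun v => if v ∈ B then τ (f v) else f v, ?_, by simp [haB], by simp [hbB], ?_⟩
    · intro u hu v hv huv
      have huv' := hf u hu v hv huv
      dsimp only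
      by_cases huB : u ∈ B <;> by_cases hvB : v ∈ B <;> simp only [huB, hvB, if_true, if_false]
      · exact hτinj _ _ (hBA u huB).2 (hBA v hvB).2 huv'
      · have hvb : f v = f b := by
          by_contra hvb
          exact hvB (hcl u huB v hv huv hvb)
        rw [hvb]
        exact (hτ _ (hBA u huB).2).2.1
      · have hub : f u = f b := by
          by_contra hub
          exact huB (hcl v hvB u hu huv.symm hub)
        rw [hub]
        exact (hτ _ (hBA v hvB).2).2.1.symm
      · exact huv'
    · simp only [haB, hcB, if_true, if_false]
      have := hτ _ hfc.symm
      constructor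
      · intro h1 h2
        exact this.1 (h1.symm.trans h2)
      · intro h1
        exact (this.2.2 _ hfa h1).symm

lemma parity_of_colours {f : V → Fin 3} {m k : Fin 3} {a c : V} (p : G.Walk a c)
    (hm : ∀ v ∈ p.support, f v ≠ m)
    (hp : ∀ u ∈ p.support, ∀ v ∈ p.support, G.Adj u v → f u ≠ f v) (hk : k ≠ m) :
    (p.length % 2 = 0 ↔ (f a = k ↔ f c = k)) := by
  induction p with
  | nil => simp
  | @cons u v w huv p ih =>
    have h1 := hp u (by simp) v (by simp) huv
    have h2 := hm u (by simp)
    have h3 := hm v (by simp)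
    have := ih (fun v hv => hm v (by simp [hv]))
      fun u hu v hv => hp u (by simp [hu]) v (by simp [hv])
    have h4 : f u = k ↔ ¬ f v = k := by omega
    rw [Walk.length_cons, h4]
    have : (p.length + 1) % 2 = 0 ↔ ¬ p.length % 2 = 0 := by omega
    tauto

/-- The two sides of a separation by a path `a b c` cannot be coloured consistently. -/
structure CutPath (G : SimpleGraph V) (a b c : V) (D E : Set V) : Prop where
  hab : G.Adj a b
  hbc : G.Adj b c
  hac : a ≠ c
  cover : ∀ v, v ∈ D ∨ v ∈ E ∨ v = a ∨ v = b ∨ v = c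
  disj : ∀ v ∈ D, v ∉ E
  not_adj : ∀ u ∈ D, ∀ v ∈ E, ¬ G.Adj u v
  notMem : ∀ v, v = a ∨ v = b ∨ v = c → v ∉ D ∧ v ∉ E

namespace CutPath

variable {a b c : V} {D E : Set V}

lemma symm (h : CutPath G a b c D E) : CutPath G a b c E D where
  hab := h.hab
  hbc := h.hbc
  hac := h.hac
  cover v := or_left_comm.1 (h.cover v)
  disj v hv hv' := h.disj v hv' hv
  not_adj u hu v hv huv := h.not_adj v hv u hu huv.symm
  notMem v hv := (h.notMem v hv).symm

lemma glue (h : CutPath G a b c D E) (hc : VertexCritical 4 G) {f g : V → Fin 3}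
    (hf : ProperOn G Eᶜ f) (hg : ProperOn G Dᶜ g) (hfg : f a = f c ↔ g a = g c) : False := by
  classical
  have ha := h.notMem a (.inl rfl)
  have hb := h.notMem b (.inr (.inl rfl))
  have hc' := h.notMem c (.inr (.inr rfl))
  have f1 := hf a ha.2 b hb.2 h.hab
  have f2 := hf b hb.2 c hc'.2 h.hbc
  have g1 := hg a ha.1 b hb.1 h.hab
  have g2 := hg b hb.1 c hc'.1 h.hbc
  obtain ⟨σ, σa, σb⟩ : ∃ σ : Equiv.Perm (Fin 3), σ (g a) = f a ∧ σ (g b) = f b := by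
    have h1 : f a ≠ Equiv.swap (g a) (f a) (g b) := by
      intro h
      apply g1
      apply (Equiv.swap (g a) (f a)).injective
      rw [← h, Equiv.swap_apply_left]
    refine ⟨(Equiv.swap (g a) (f a)).trans (Equiv.swap (Equiv.swap (g a) (f a) (g b)) (f b)),
      ?_, ?_⟩
    · rw [Equiv.trans_apply, Equiv.swap_apply_left, Equiv.swap_apply_of_ne_of_ne h1 f1]
    · rw [Equiv.trans_apply, Equiv.swap_apply_left]
  have σc : σ (g c) = f c := by
    by_cases hfac : f a = f c
    · rw [← hfg.1 hfac, σa, hfac]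
    · have h1 : σ (g c) ≠ f a := σa ▸ fun h => hfac (hfg.2 (σ.injective h).symm)
      have h2 : σ (g c) ≠ f b := σb ▸ fun h => g2 (σ.injective h).symm
      omega
  have hS : ∀ v, v ∉ D → v ∉ E → σ (g v) = f v := by
    intro v hD hE
    rcases h.cover v with hv | hv | rfl | rfl | rfl
    · exact (hD hv).elim
    · exact (hE hv).elim
    all_goals assumption
  refine hc.not_properOn (fun v => if v ∈ D then f v else σ (g v)) fun u _ v _ huv => ?_
  dsimp only
  by_cases hu : u ∈ D <;> by_cases hv : v ∈ D <;> simp only [hu, hv, if_true, if_false]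
  · exact hf u (h.disj u hu) v (h.disj v hv) huv
  · have hvE : v ∉ E := fun hE => h.not_adj u hu v hE huv
    rw [hS v hv hvE]
    exact hf u (h.disj u hu) v hvE huv
  · have huE : u ∉ E := fun hE => h.not_adj v hv u hE huv.symm
    rw [hS u hu huE]
    exact hf u huE v (h.disj v hv) huv
  · exact σ.injective.ne (hg u hu v hv huv)

lemma false_of_ne {ℓ : ℕ} (hℓ : 5 ≤ ℓ) (hG : InGFamily ℓ G) (h : CutPath G a b c D E)
    (hc : VertexCritical 4 G) {f g : V → Fin 3} (hf : ProperOn G Eᶜ f) (hg : ProperOn G Dᶜ g)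
    (hfac : f a = f c) (hgac : g a ≠ g c) : False := by
  have ha := h.notMem a (.inl rfl)
  have hb := h.notMem b (.inr (.inl rfl))
  have hc' := h.notMem c (.inr (.inr rfl))
  rcases hf.kempe ha.2 hb.2 hc'.2 h.hab h.hbc with ⟨p, hp, hpA, hpi⟩ | ⟨f', hf', -, -, hfac'⟩
  swap
  · exact h.glue hc hf' hg (by tauto)
  rcases hg.kempe ha.1 hb.1 hc'.1 h.hab h.hbc with ⟨q, hq, hqA, hqi⟩ | ⟨g', hg', -, -, hgac'⟩
  swap
  · exact h.glue hc hf hg' (by tauto)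
  have hpl := (parity_of_colours p (fun v hv => (hpA v hv).2)
    (fun u hu v hv => hf u (hpA u hu).1 v (hpA v hv).1) (hf a ha.2 b hb.2 h.hab)).2 (by simp [hfac])
  have hql := (parity_of_colours q (fun v hv => (hqA v hv).2)
    (fun u hu v hv => hg u (hqA u hu).1 v (hqA v hv).1) (hg a ha.1 b hb.1 h.hab)).not.2
    (by simpa using hgac.symm)
  have hbp : b ∉ p.support := fun hb => (hpA b hb).2 rfl
  have hbq : b ∉ q.support := fun hb => (hqA b hb).2 rfl
  have hpath : (Walk.cons h.hab h.hbc.toWalk).IsPath := by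
    simp [Walk.cons_isPath_iff, h.hbc.ne, h.hac, h.hab.ne]
  have hp2 := hG.le_add_length hp hpath (by rintro rfl; simp at hbp)
  have hq2 := hG.le_add_length hq hpath (by rintro rfl; simp at hbq)
  simp only [Walk.length_cons, Walk.length_nil, Adj.toWalk] at hp2 hq2
  have hfr : IndFrame [⟨a, c, p⟩, ⟨a, c, q⟩] := by
    refine ⟨⟨by simp [hp, hq], by simp [h.hac], ?_⟩, ?_⟩
    · simp only [List.pairwise_cons, List.mem_cons, List.not_mem_nil, or_false, forall_eq,
        IsEmpty.forall_iff, implies_true, List.Pairwise.nil, and_true]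
      intro v hvp hvq
      rcases h.cover v with hv | hv | rfl | rfl | rfl
      · exact ((hqA v hvq).1 hv).elim
      · exact ((hpA v hvp).1 hv).elim
      · simp [Arc.IsEnd]
      · exact (hbp hvp).elim
      · simp [Arc.IsEnd]
    · have key : ∀ u ∈ p.support, ∀ v ∈ q.support, G.Adj u v →
          s(u, v) ∈ p.edges ∨ s(u, v) ∈ q.edges := by
        intro u hu v hv huv
        rcases h.cover v with hv' | hv' | rfl | rfl | rfl
        · exact ((hqA v hv).1 hv').elim
        · rcases h.cover u with hu' | hu' | rfl | rfl | rfl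
          · exact (h.not_adj u hu' v hv' huv).elim
          · exact ((hpA u hu).1 hu').elim
          · exact .inr (hqi _ (by simp) _ hv huv)
          · exact (hbp hu).elim
          · exact .inr (hqi _ (by simp) _ hv huv)
        · exact .inl (hpi _ hu _ (by simp) huv)
        · exact (hbq hv).elim
        · exact .inl (hpi _ hu _ (by simp) huv)
      simp only [List.forall_mem_cons, List.exists_mem_cons_iff, List.not_mem_nil, false_and,
        exists_false, or_false, IsEmpty.forall_iff, implies_true, and_true]
      refine ⟨⟨fun u hu v hv huv => .inl (hpi u hu v hv huv), key⟩,
        fun u hu v hv huv => ?_, fun u hu v hv huv => .inr (hqi u hu v hv huv)⟩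
      rw [Sym2.eq_swap]
      exact key v hv u hu huv.symm
  have hac := h.hac
  have : CycLen ℓ (p.length + q.length) :=
    hfr.cycLen (by omega) hG [(0, true), (1, false)] (by simp) (by simp [pickArcs]; grind)
  have := this.2 (by omega)
  omega

/-- A graph of `𝒢ℓ` with a separating path on three vertices is not 4-vertex-critical. -/
lemma not_vertexCritical {ℓ : ℕ} (hℓ : 5 ≤ ℓ) (hG : InGFamily ℓ G) (h : CutPath G a b c D E)
    (hD : D.Nonempty) (hE : E.Nonempty) : ¬ VertexCritical 4 G := by
  intro hc
  obtain ⟨d, hd⟩ := hD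
  obtain ⟨e, he⟩ := hE
  obtain ⟨f, hf⟩ := hc.exists_properOn e
  obtain ⟨g, hg⟩ := hc.exists_properOn d
  have hf : ProperOn G Eᶜ f := fun u hu v hv =>
    hf u (fun h => hu (h ▸ he)) v (fun h => hv (h ▸ he))
  have hg : ProperOn G Dᶜ g := fun u hu v hv =>
    hg u (fun h => hu (h ▸ hd)) v (fun h => hv (h ▸ hd))
  by_cases hfac : f a = f c <;> by_cases hgac : g a = g c
  · exact h.glue hc hf hg (by tauto)
  · exact h.false_of_ne hℓ hG hc hf hg hfac hgac
  · exact h.symm.false_of_ne hℓ hG hc hg hf hgac hfac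
  · exact h.glue hc hf hg (by tauto)

end CutPath
end Cut

section Residual

lemma Frame.notMem_arcVerts {G : SimpleGraph V} {L L' : List (Arc G)} (h : Frame L)
    (hL : ∀ f ∈ L', f ∈ L) {y : V} (hy : ∃ e ∈ L, e.IsEnd y) (hy' : ∀ f ∈ L', ¬ f.IsEnd y) :
    y ∉ arcVerts L' := by
  rintro ⟨f, hf, hyf⟩
  obtain ⟨e, he, hye⟩ := hy
  exact hy' f hf (h.isEnd_of_isEnd he (hL f hf) hye hyf)

lemma ear_u4_x_false {G : SimpleGraph V} {ℓ : ℕ} (hℓ : 5 ≤ ℓ) (hG : InGFamily ℓ G)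
    {u1 u2 u3 u4 x : V} {F : G.Walk x u4} {A : G.Walk u2 x} {B : G.Walk x u3} {P1 : G.Walk u1 u2}
    {Q2 : G.Walk u1 u4} {L1 : G.Walk u1 u3} {L2 : G.Walk u2 u4}
    (h : IndFrame [⟨x, u4, F⟩, ⟨u2, x, A⟩, ⟨x, u3, B⟩, ⟨u1, u2, P1⟩, ⟨u1, u4, Q2⟩,
      ⟨u1, u3, L1⟩, ⟨u2, u4, L2⟩]) (hu : [u1, u2, u3, u4, x].Nodup) (hF : 2 ≤ F.length)
    (hA : A.length + 1 = ℓ) (hB : B.length = 1) (hP : P1.length = ℓ) (hQ : Q2.length = ℓ)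
    (hL1 : L1.length = 1) (hL2 : L2.length = 1) : False := by
  simp only [List.nodup_cons, List.mem_cons, List.not_mem_nil, or_false, not_or] at hu
  have c1 : CycLen ℓ (F.length + L2.length + A.length) :=
    h.cycLen (by omega) hG [(0, true), (6, false), (1, true)] (by simp [pickArcs]; grind)
      (by simp [pickArcs]; grind)
  have c2 : CycLen ℓ (F.length + Q2.length + L1.length + B.length) :=
    h.cycLen (by omega) hG [(0, true), (4, false), (5, true), (2, false)]
      (by simp [pickArcs]; grind) (by simp [pickArcs]; grind)
  have c3 : CycLen ℓ (F.length + L2.length + P1.length + L1.length + B.length) :=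
    h.cycLen (by omega) hG [(0, true), (6, false), (3, false), (5, true), (2, false)]
      (by simp [pickArcs]; grind) (by simp [pickArcs]; grind)
  unfold CycLen at c1 c2 c3
  omega

lemma length_eq_of_ear_u4_u3 {G : SimpleGraph V} {ℓ : ℕ} (hℓ : 5 ≤ ℓ) (hG : InGFamily ℓ G)
    {u1 u2 u3 u4 x : V} {F : G.Walk u3 u4} {A : G.Walk u2 x} {B : G.Walk x u3} {P1 : G.Walk u1 u2}
    {Q2 : G.Walk u1 u4} {L1 : G.Walk u1 u3} {L2 : G.Walk u2 u4}
    (h : IndFrame [⟨u3, u4, F⟩, ⟨u2, x, A⟩, ⟨x, u3, B⟩, ⟨u1, u2, P1⟩, ⟨u1, u4, Q2⟩,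
      ⟨u1, u3, L1⟩, ⟨u2, u4, L2⟩]) (hu : [u1, u2, u3, u4, x].Nodup) (hF : 2 ≤ F.length)
    (hA : A.length + 1 = ℓ) (hP : P1.length = ℓ) (hQ : Q2.length = ℓ)
    (hL1 : L1.length = 1) (hL2 : L2.length = 1) : F.length = ℓ := by
  simp only [List.nodup_cons, List.mem_cons, List.not_mem_nil, or_false, not_or] at hu
  have c2 : CycLen ℓ (F.length + Q2.length + L1.length) :=
    h.cycLen (by omega) hG [(0, true), (4, false), (5, true)]
      (by simp [pickArcs]; grind) (by simp [pickArcs]; grind)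
  have c3 : CycLen ℓ (F.length + L2.length + P1.length + L1.length) :=
    h.cycLen (by omega) hG [(0, true), (6, false), (3, false), (5, true)]
      (by simp [pickArcs]; grind) (by simp [pickArcs]; grind)
  unfold CycLen at c2 c3
  omega

namespace Config

variable {G : SimpleGraph V} {ℓ : ℕ} {u1 u2 u3 u4 x y z : V}
  {P1 : G.Walk u1 u2} {P2 : G.Walk u3 u4} {Q1 : G.Walk u2 u3} {Q2 : G.Walk u1 u4}
  {L1 : G.Walk u1 u3} {L2 : G.Walk u2 u4}

lemma length_eq_of_L1 (h : Config ℓ P1 P2 Q1 Q2 L1 L2) (hl : L1.length = 1) :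
    P1.length = ℓ ∧ P2.length = ℓ ∧ Q1.length = ℓ ∧ Q2.length = ℓ ∧ L2.length = 1 := by
  have := h.hs
  have := h.hP
  have := h.hQ
  have := h.hL
  have := h.hPl
  have := h.hQP
  omega

/-- A neighbour of `u3` on `Q1` splits `Q1` into a path of length `ℓ - 1` and an edge. -/
lemma exists_append (h : Config ℓ P1 P2 Q1 Q2 L1 L2) (hℓ : 5 ≤ ℓ) (hG : InGFamily ℓ G)
    (hx : x ∈ Q1.support) (hx3 : G.Adj x u3) :
    ∃ (A : G.Walk u2 x) (B : G.Walk x u3), Q1 = A.append B ∧ B.length = 1 := by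
  obtain ⟨A, B, rfl⟩ := Walk.mem_support_iff_exists_append.1 hx
  refine ⟨A, B, rfl, ?_⟩
  by_contra hB
  have hp : (A.append B).IsPath := h.frame.path ⟨_, _, A.append B⟩ (by simp)
  have := hG.le_add_length hp.of_append_right (q := hx3.toWalk) (by simpa using hx3.ne) (by
    rintro rfl
    simp at hB)
  have := h.hQP
  have := h.hPl
  simp at *
  omega

lemma frame_splitQ {A : G.Walk u2 x} {B : G.Walk x u3}
    (h : Config ℓ P1 P2 (A.append B) Q2 L1 L2) (hx2 : x ≠ u2) (hx3 : x ≠ u3) :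
    IndFrame [⟨u2, x, A⟩, ⟨x, u3, B⟩, ⟨u1, u2, P1⟩, ⟨u3, u4, P2⟩, ⟨u1, u4, Q2⟩,
      ⟨u1, u3, L1⟩, ⟨u2, u4, L2⟩] := by
  have h1 : IndFrame [⟨u2, u3, A.append B⟩, ⟨u1, u2, P1⟩, ⟨u3, u4, P2⟩, ⟨u1, u4, Q2⟩,
      ⟨u1, u3, L1⟩, ⟨u2, u4, L2⟩] :=
    h.frame.pick [(2, true), (0, true), (1, true), (3, true), (4, true), (5, true)]
      (by decide) (by simp)
  exact h1.split hx2 hx3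

lemma notMem_endQ (h : Config ℓ P1 P2 Q1 Q2 L1 L2) (hx : x ∈ Q1.support) (hx2 : x ≠ u2)
    (hx3 : x ≠ u3) : x ≠ u1 ∧ x ≠ u4 := by
  have hd := h.frame.toFrame.disj_of_getElem? (i := 2) (j := 3) rfl rfl (by decide)
  constructor <;> rintro rfl
  · rcases (hd x hx (by simp)).1 with h | h
    · exact hx2 h
    · exact hx3 h
  · rcases (hd x hx (by simp)).1 with h | h
    · exact hx2 h
    · exact hx3 h

lemma ear_u1_false (h : Config ℓ P1 P2 Q1 Q2 L1 L2) (hℓ : 5 ≤ ℓ) (hG : InGFamily ℓ G)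
    (hl : L1.length = 1) (hx : x ∈ Q1.support) (hx2 : x ≠ u2) (hx3 : G.Adj x u3)
    {E : G.Walk x u1} (hE : Ear {v | v ∈ arcVerts (k4Arcs P1 P2 Q1 Q2 L1 L2) ∧ v ≠ u3} E)
    (hX : ∀ v ∈ E.support, v ≠ x → v ≠ u1 → v ∉ arcVerts (k4Arcs P1 P2 Q1 Q2 L1 L2)) :
    False := by
  have hx14 := h.notMem_endQ hx hx2 hx3.ne
  obtain ⟨hp, hp', hq, hq', hl'⟩ := h.length_eq_of_L1 hl
  obtain ⟨A, B, rfl, hB⟩ := h.exists_append hℓ hG hx hx3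
  have hu := h.nodup
  simp only [List.nodup_cons, List.mem_cons, List.not_mem_nil, or_false, not_or] at hu
  have h1 : IndFrame [⟨u2, x, A⟩, ⟨u1, u2, P1⟩, ⟨u1, u4, Q2⟩, ⟨u2, u4, L2⟩] :=
    (h.frame_splitQ hx2 hx3.ne).pick [(0, true), (2, true), (4, true), (6, true)] (by decide)
      (by simp [pickArcs, Arc.IsEnd]; have := hx3.ne; grind)
  have h3 : ∀ v ∈ arcVerts [⟨u2, x, A⟩, ⟨u1, u2, P1⟩, ⟨u1, u4, Q2⟩, (⟨u2, u4, L2⟩ : Arc G)],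
      v ≠ u3 := by
    have := hx3.ne
    rintro v hv rfl
    exact (h.frame_splitQ hx2 hx3.ne).toFrame.notMem_arcVerts (y := v) (by simp)
      (by simp [Arc.IsEnd]) (by simp [Arc.IsEnd]; grind) hv
  have h2 := h1.addEar (hE.mono fun v hv => ⟨by simp [arcVerts] at hv ⊢; tauto, h3 v hv⟩)
    (by simp [Arc.IsEnd]) (by simp [Arc.IsEnd])
  rw [Walk.length_append] at hq
  have hE2 := hE.two_le
  have c1 : CycLen ℓ (E.length + P1.length + A.length) :=
    h2.cycLen (by omega) hG [(0, true), (2, true), (1, true)] (by simp [pickArcs]; grind)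
      (by simp [pickArcs]; grind)
  have c2 : CycLen ℓ (E.length + Q2.length + L2.length + A.length) :=
    h2.cycLen (by omega) hG [(0, true), (3, true), (4, false), (1, true)]
      (by simp [pickArcs]; grind) (by simp [pickArcs]; grind)
  have hE' : E.length = 2 := by
    unfold CycLen at c1 c2
    omega
  have hL : G.Adj u1 u3 := Walk.adj_of_length_eq_one hl
  have := hG.le_add_length hE.path (q := Walk.cons hx3 hL.symm.toWalk) (by
    have := hL.ne'
    have := hx3.ne
    simp [Walk.cons_isPath_iff]
    grind) (by
    rintro rfl
    exact hX u3 (by simp) hx3.ne' hL.ne' (by simp [arcVerts]))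
  simp at this
  omega

lemma exists_append_P2 (h : Config ℓ P1 P2 Q1 Q2 L1 L2) (hℓ : 5 ≤ ℓ) (hG : InGFamily ℓ G)
    (hy : y ∈ P2.support) (hy3 : G.Adj u3 y) :
    ∃ (T1 : G.Walk u3 y) (T2 : G.Walk y u4), P2 = T1.append T2 ∧ T1.length = 1 := by
  obtain ⟨T1, T2, rfl⟩ := Walk.mem_support_iff_exists_append.1 hy
  refine ⟨T1, T2, rfl, ?_⟩
  by_contra hB
  have hp : (T1.append T2).IsPath := h.frame.path ⟨_, _, T1.append T2⟩ (by simp)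
  have := hG.le_add_length hp.of_append_left (q := hy3.toWalk) (by simpa using hy3.ne) (by
    rintro rfl
    simp at hB)
  have := h.hP
  have := h.hPl
  simp at *
  omega

lemma exists_frame_of_eq {A : G.Walk u2 x} {B : G.Walk x u3} {T : G.Walk u3 y} {R : G.Walk y u4}
    (h : IndFrame [⟨y, u4, R⟩, ⟨u2, x, A⟩, ⟨x, u3, B⟩, ⟨u3, y, T⟩, ⟨u1, u2, P1⟩,
      ⟨u1, u4, Q2⟩, ⟨u1, u3, L1⟩, ⟨u2, u4, L2⟩]) (hu : [u1, u2, u3, u4, x, y].Nodup)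
    {w : V} (hw : w = x ∨ w = u3) {E : G.Walk w u4}
    (hE : Ear {v | v ∈ arcVerts [⟨y, u4, R⟩, ⟨u2, x, A⟩, ⟨x, u3, B⟩, ⟨u3, y, T⟩, ⟨u1, u2, P1⟩,
      ⟨u1, u4, Q2⟩, ⟨u1, u3, L1⟩, (⟨u2, u4, L2⟩ : Arc G)] ∧ v ≠ y} E) :
    IndFrame [⟨w, u4, E⟩, ⟨u2, x, A⟩, ⟨x, u3, B⟩, ⟨u1, u2, P1⟩, ⟨u1, u4, Q2⟩,
      ⟨u1, u3, L1⟩, ⟨u2, u4, L2⟩] := by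
  simp only [List.nodup_cons, List.mem_cons, List.not_mem_nil, or_false, not_or] at hu
  obtain ⟨⟨_, _, _, _, hy1⟩, ⟨_, _, _, hy2⟩, ⟨_, _, hy3⟩, ⟨_, hy4⟩, hyx, _⟩ := hu
  have h3 : IndFrame [⟨u2, x, A⟩, ⟨x, u3, B⟩, ⟨u1, u2, P1⟩, ⟨u1, u4, Q2⟩, ⟨u1, u3, L1⟩,
      ⟨u2, u4, L2⟩] :=
    h.pick [(1, true), (2, true), (4, true), (5, true), (6, true), (7, true)] (by decide)
      (by simp [pickArcs, Arc.IsEnd, Ne.symm hy1, Ne.symm hy2, Ne.symm hy3, Ne.symm hy4,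
        Ne.symm hyx])
  refine h3.addEar (hE.mono fun v hv => ⟨?_, ?_⟩) ?_ (by simp [Arc.IsEnd])
  · simp [arcVerts] at hv ⊢
    tauto
  · rintro rfl
    exact h.toFrame.notMem_arcVerts (by simp) (by simp [Arc.IsEnd])
      (by simp [Arc.IsEnd, Ne.symm hy1, Ne.symm hy2, Ne.symm hy3, Ne.symm hy4, Ne.symm hyx]) hv
  · rcases hw with rfl | rfl <;> simp [Arc.IsEnd]

lemma exists_frame_of_ne {A : G.Walk u2 x} {B : G.Walk x u3} {T : G.Walk u3 y} {R : G.Walk y z}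
    {M : G.Walk z u4}
    (h : IndFrame [⟨y, z, R⟩, ⟨z, u4, M⟩, ⟨u2, x, A⟩, ⟨x, u3, B⟩, ⟨u3, y, T⟩, ⟨u1, u2, P1⟩,
      ⟨u1, u4, Q2⟩, ⟨u1, u3, L1⟩, ⟨u2, u4, L2⟩]) (hu : [u1, u2, u3, u4, x, y, z].Nodup)
    {w : V} (hw : w = x ∨ w = u3) {E : G.Walk w z}
    (hE : Ear {v | v ∈ arcVerts [⟨y, z, R⟩, ⟨z, u4, M⟩, ⟨u2, x, A⟩, ⟨x, u3, B⟩, ⟨u3, y, T⟩,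
      ⟨u1, u2, P1⟩, ⟨u1, u4, Q2⟩, ⟨u1, u3, L1⟩, (⟨u2, u4, L2⟩ : Arc G)] ∧ v ≠ y} E) :
    IndFrame [⟨w, u4, E.append M⟩, ⟨u2, x, A⟩, ⟨x, u3, B⟩, ⟨u1, u2, P1⟩, ⟨u1, u4, Q2⟩,
      ⟨u1, u3, L1⟩, ⟨u2, u4, L2⟩] := by
  simp only [List.nodup_cons, List.mem_cons, List.not_mem_nil, or_false, not_or] at hu
  obtain ⟨⟨_, _, _, _, hy1, hz1⟩, ⟨_, _, _, hy2, hz2⟩, ⟨h34, _, hy3, hz3⟩, ⟨h4x, hy4, hz4⟩,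
    ⟨hyx, hzx⟩, hyz, _⟩ := hu
  have h4 : IndFrame [⟨z, u4, M⟩, ⟨u2, x, A⟩, ⟨x, u3, B⟩, ⟨u1, u2, P1⟩, ⟨u1, u4, Q2⟩,
      ⟨u1, u3, L1⟩, ⟨u2, u4, L2⟩] :=
    h.pick [(1, true), (2, true), (3, true), (5, true), (6, true), (7, true), (8, true)]
      (by decide) (by simp [pickArcs, Arc.IsEnd, Ne.symm hy1, Ne.symm hy2, Ne.symm hy3,
        Ne.symm hy4, Ne.symm hyx, hyz])
  have h5 : IndFrame [⟨w, z, E⟩, ⟨z, u4, M⟩, ⟨u2, x, A⟩, ⟨x, u3, B⟩, ⟨u1, u2, P1⟩,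
      ⟨u1, u4, Q2⟩, ⟨u1, u3, L1⟩, ⟨u2, u4, L2⟩] := by
    refine h4.addEar (hE.mono fun v hv => ⟨?_, ?_⟩) ?_ (by simp [Arc.IsEnd])
    · simp [arcVerts] at hv ⊢
      tauto
    · rintro rfl
      exact h.toFrame.notMem_arcVerts (by simp) (by simp [Arc.IsEnd])
        (by simp [Arc.IsEnd, Ne.symm hy1, Ne.symm hy2, Ne.symm hy3, Ne.symm hy4, Ne.symm hyx,
          hyz]) hv
    · rcases hw with rfl | rfl <;> simp [Arc.IsEnd]
  refine h5.merge ?_ ?_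
  · rcases hw with rfl | rfl
    · exact Ne.symm h4x
    · exact h34
  · simp [Arc.IsEnd, Ne.symm hz1, Ne.symm hz2, Ne.symm hz3, Ne.symm hz4, Ne.symm hzx]

/-- Removing a neighbour of `u3` on `P2` and its successors up to `z`, and adding an ear at `z`. -/
lemma exists_frame (h : Config ℓ P1 P2 Q1 Q2 L1 L2) {A : G.Walk u2 x} {B : G.Walk x u3}
    {T : G.Walk u3 y} {R : G.Walk y z} {M : G.Walk z u4} (hQ : Q1 = A.append B)
    (hP : P2 = T.append (R.append M)) (hx2 : x ≠ u2) (hx3 : x ≠ u3) (hy3 : y ≠ u3)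
    (hy4 : y ≠ u4) (hzy : z ≠ y) (hz3 : z ≠ u3) (hxy : x ≠ y) {w : V} (hw : w = x ∨ w = u3)
    {E : G.Walk w z} (hE : Ear {v | v ∈ arcVerts (k4Arcs P1 P2 Q1 Q2 L1 L2) ∧ v ≠ y} E) :
    ∃ F : G.Walk w u4, F.length = E.length + M.length ∧
      IndFrame [⟨w, u4, F⟩, ⟨u2, x, A⟩, ⟨x, u3, B⟩, ⟨u1, u2, P1⟩, ⟨u1, u4, Q2⟩,
      ⟨u1, u3, L1⟩, ⟨u2, u4, L2⟩] := by
  subst hQ hP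
  obtain ⟨hy1, hy2⟩ := h.notMem_end (y := y) (by simp) hy3 hy4
  obtain ⟨hx1, hx4⟩ := h.notMem_endQ (x := x) (by simp) hx2 hx3
  have hu := h.nodup
  simp only [List.nodup_cons, List.mem_cons, List.not_mem_nil, or_false, not_or] at hu
  obtain ⟨⟨h12, h13, h14⟩, ⟨h23, h24⟩, h34, -⟩ := hu
  have h1 : IndFrame [⟨u2, u3, A.append B⟩, ⟨u3, y, T⟩, ⟨y, u4, R.append M⟩, ⟨u1, u2, P1⟩,
      ⟨u1, u4, Q2⟩, ⟨u1, u3, L1⟩, ⟨u2, u4, L2⟩] :=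
    (h.frame_split hy3 hy4).pick [(3, true), (0, true), (1, true), (2, true), (4, true),
      (5, true), (6, true)] (by decide) (by simp)
  have h2 : IndFrame [⟨y, u4, R.append M⟩, ⟨u2, x, A⟩, ⟨x, u3, B⟩, ⟨u3, y, T⟩, ⟨u1, u2, P1⟩,
      ⟨u1, u4, Q2⟩, ⟨u1, u3, L1⟩, ⟨u2, u4, L2⟩] :=
    (h1.split hx2 hx3).pick [(3, true), (0, true), (1, true), (2, true), (4, true),
      (5, true), (6, true), (7, true)] (by decide) (by simp)
  by_cases hz4 : z = u4
  · subst hz4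
    have hM : M.length = 0 := by
      have hM : M.IsPath := ((h2.path _ List.mem_cons_self).of_append_right)
      rw [Walk.isPath_iff_nil] at hM
      exact Walk.length_eq_zero_iff.2 hM
    refine ⟨E, by omega, exists_frame_of_eq h2 ?_ hw (hE.mono fun v hv => ?_)⟩
    · simp [h12, h13, h14, h23, h24, h34, hxy, Ne.symm hy1, Ne.symm hy2, Ne.symm hy3,
        Ne.symm hy4, Ne.symm hx1, Ne.symm hx2, Ne.symm hx3, Ne.symm hx4]
    · simp [arcVerts] at hv ⊢
      tauto
  · obtain ⟨hz1, hz2⟩ := h.notMem_end (y := z) (by simp) hz3 hz4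
    have hzx : z ≠ x := by
      rintro rfl
      have hd := h1.toFrame.disj_of_getElem? (i := 0) (j := 2) rfl rfl (by decide) z (by simp)
        (by simp)
      rcases hd.1 with hd | hd
      exacts [hz2 hd, hz3 hd]
    refine ⟨E.append M, by simp, exists_frame_of_ne (h2.split hzy hz4) ?_ hw
      (hE.mono fun v hv => ?_)⟩
    · simp [h12, h13, h14, h23, h24, h34, hxy, Ne.symm hy1, Ne.symm hy2, Ne.symm hy3,
        Ne.symm hy4, Ne.symm hx1, Ne.symm hx2, Ne.symm hx3, Ne.symm hx4, Ne.symm hz1,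
        Ne.symm hz2, Ne.symm hz3, Ne.symm hz4, Ne.symm hzx, Ne.symm hzy]
    · refine ⟨?_, hv.2⟩
      have hv' := hv.1
      simp only [arcVerts, List.mem_cons, List.not_mem_nil, or_false, exists_eq_or_imp,
        exists_eq_left, Walk.mem_support_append_iff] at hv' ⊢
      grind

lemma ear_P2_false (h : Config ℓ P1 P2 Q1 Q2 L1 L2) (hℓ : 5 ≤ ℓ) (hG : InGFamily ℓ G)
    (hl : L1.length = 1) (hx : x ∈ Q1.support) (hx2 : x ≠ u2) (hx3 : G.Adj x u3)
    (hy : y ∈ P2.support) (hy4 : y ≠ u4) (hy3 : G.Adj u3 y) (hxy : x ≠ y)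
    (hz : z ∈ P2.support) (hz3 : z ≠ u3) (hzy : z ≠ y) {w : V} (hw : w = x ∨ w = u3)
    {E : G.Walk w z} (hE : Ear {v | v ∈ arcVerts (k4Arcs P1 P2 Q1 Q2 L1 L2) ∧ v ≠ y} E)
    (hX : ∀ v ∈ E.support, v ≠ w → v ≠ z → v ∉ arcVerts (k4Arcs P1 P2 Q1 Q2 L1 L2)) :
    False := by
  have hx14 := h.notMem_endQ hx hx2 hx3.ne
  obtain ⟨hp, hp', hq, hq', hl'⟩ := h.length_eq_of_L1 hl
  obtain ⟨A, B, hAB, hB⟩ := h.exists_append hℓ hG hx hx3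
  obtain ⟨T1, T2, hT, hT1⟩ := h.exists_append_P2 hℓ hG hy hy3
  have hz2 : z ∈ T2.support := by
    rw [hT, Walk.mem_support_append_iff] at hz
    rcases hz with hz | hz
    · match T1, hT1 with
      | .cons h .nil, _ => simp at hz; tauto
    · exact hz
  obtain ⟨R, M, rfl⟩ := Walk.mem_support_iff_exists_append.1 hz2
  obtain ⟨F, hFl, hF⟩ := h.exists_frame hAB hT hx2 hx3.ne hy3.ne' hy4 hzy hz3 hxy hw hE
  have hu : [u1, u2, u3, u4, x].Nodup := by
    have hu := h.nodup
    have := hx3.ne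
    simp only [List.nodup_cons, List.mem_cons] at hu ⊢
    grind
  have hPath : P2.IsPath := h.frame.path ⟨u3, u4, P2⟩ (by simp)
  have hE2 := hE.two_le
  have hql : A.length + B.length = ℓ := by rw [← hq, hAB, Walk.length_append]
  have hpl : T1.length + (R.length + M.length) = ℓ := by
    rw [← hp', hT, Walk.length_append, Walk.length_append]
  rcases hw with rfl | rfl
  · exact ear_u4_x_false hℓ hG hF hu (by omega) (by omega) hB hp hq' hl hl'
  · have hFℓ := length_eq_of_ear_u4_u3 hℓ hG hF hu (by omega) (by omega) hp hq' hl hl'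
    rw [hT, Walk.append_assoc] at hPath
    have := hG.le_add_length hE.path hPath.of_append_left (by
      rintro rfl
      exact hX y (by simp) hy3.ne' hzy.symm ⟨⟨w, u4, P2⟩, by simp, hy⟩)
    rw [Walk.length_append] at this
    omega

end Config
end Residual

section Attach

variable {G : SimpleGraph V}

/-- A walk outside `X` from a neighbour of `F` to a neighbour of `z` contains an ear. -/
lemma exists_ear {X Y F : Set V} {f₀ z s₀ r : V} {w : G.Walk s₀ r} (hFY : F ⊆ Y) (hYX : Y ⊆ X)
    (hz : z ∈ Y) (hzF : z ∉ F) (hf : f₀ ∈ F) (hs : G.Adj s₀ f₀) (hr : G.Adj r z)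
    (hw : ∀ v ∈ w.support, v ∉ X)
    (hadj : ∀ v ∈ w.support, ∀ u ∈ Y, G.Adj v u → u ∈ F ∨ v = r ∧ u = z)
    (huniq : ∀ v ∉ X, ∀ a ∈ X, ∀ b ∈ X, G.Adj v a → G.Adj v b → a = b) :
    ∃ f ∈ F, ∃ E : G.Walk f z, Ear Y E ∧ ∀ v ∈ E.support, v ≠ f → v ≠ z → v ∉ X := by
  obtain ⟨s, t, q, hq, hqw, ⟨f, hfF, hsf⟩, rfl, hqS, -, hqi⟩ :=
    exists_shortest_path (A := {v | v ∈ w.support}) (S := {v | ∃ f ∈ F, G.Adj v f}) (T := {r}) w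
      ⟨f₀, hf, hs⟩ rfl (fun v hv => hv)
  have hqX : ∀ v ∈ q.support, v ∉ X := fun v hv => hw v (hqw v hv)
  have hfX := hYX (hFY hfF)
  have hfz : f ≠ z := fun h => hzF (h ▸ hfF)
  have hsupp : ∀ v ∈ (Walk.cons hsf.symm (q.concat hr)).support, v ≠ f → v ≠ z →
      v ∈ q.support := by
    intro v hv hvf hvz
    simp only [Walk.support_cons, Walk.support_concat, List.mem_cons,
      List.mem_append, List.not_mem_nil, or_false] at hv
    tauto
  refine ⟨f, hfF, Walk.cons hsf.symm (q.concat hr), ⟨?_, by simp, ?_, ?_⟩,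
    fun v hv hvf hvz => hqX v (hsupp v hv hvf hvz)⟩
  · rw [Walk.cons_isPath_iff, Walk.concat_isPath_iff]
    refine ⟨⟨hq, fun h => hqX z h (hYX hz)⟩, ?_⟩
    simp only [Walk.support_concat, List.mem_append, List.mem_cons,
      List.not_mem_nil, or_false, not_or]
    exact ⟨fun h => hqX f h hfX, hfz⟩
  · exact fun v hv hvf hvz h => hqX v (hsupp v hv hvf hvz) (hYX h)
  · intro v hv hvf hvz u hu hvu
    have hvq := hsupp v hv hvf hvz
    simp only [Walk.edges_cons, Walk.edges_concat, List.concat_eq_append, List.mem_cons,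
      List.mem_append, List.not_mem_nil, or_false]
    by_cases huq : u ∈ q.support
    · exact .inr (.inl (hqi v hvq u huq hvu))
    · have huY : u ∈ Y := by
        rcases hu with hu | hu
        · by_cases huf : u = f
          · exact huf ▸ hFY hfF
          · by_cases huz : u = z
            · exact huz ▸ hz
            · exact absurd (hsupp u hu huf huz) huq
        · exact hu
      rcases hadj v (hqw v hvq) u huY hvu with h | ⟨rfl, rfl⟩
      · obtain rfl := hqS v hvq ⟨u, h, hvu⟩
        obtain rfl := huniq v (hqX v hvq) u (hYX huY) f hfX hvu hsf
        exact .inl Sym2.eq_swap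
      · exact .inr (.inr rfl)

/-- `z` is attached to the path `x u y` of `X`: there is an ear from `z` to every choice of
vertices of the path that contains an end of the path. -/
def Attached (G : SimpleGraph V) (X : Set V) (x u y z : V) : Prop :=
  z ∈ X ∧ z ≠ x ∧ z ≠ u ∧ z ≠ y ∧ ∀ F : Set V, (∀ v ∈ F, v = x ∨ v = u ∨ v = y) →
    x ∈ F ∨ y ∈ F → ∃ f ∈ F, ∃ E : G.Walk f z,
      Ear {v | v ∈ X ∧ (v = x ∨ v = u ∨ v = y → v ∈ F)} E ∧
      ∀ v ∈ E.support, v ≠ f → v ≠ z → v ∉ X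

lemma Attached.symm {X : Set V} {x u y z : V} (h : Attached G X x u y z) :
    Attached G X y u x z := by
  obtain ⟨hz, hzx, hzu, hzy, h⟩ := h
  refine ⟨hz, hzy, hzu, hzx, fun F hF hxy => ?_⟩
  obtain ⟨f, hf, E, hE, hX⟩ := h F (fun v hv => by have := hF v hv; tauto) hxy.symm
  exact ⟨f, hf, E, hE.mono fun v hv => ⟨hv.1, fun h => hv.2 (by tauto)⟩, hX⟩

lemma exists_attached {ℓ : ℕ} (hℓ : 5 ≤ ℓ) (hG : InGFamily ℓ G) (hc : VertexCritical 4 G)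
    {X : Set V} {x u y e v1 v2 : V} (hxX : x ∈ X) (huX : u ∈ X) (hyX : y ∈ X) (heX : e ∈ X)
    (hex : e ≠ x) (heu : e ≠ u) (hey : e ≠ y) (hxu : G.Adj x u) (huy : G.Adj u y) (hxy : x ≠ y)
    (huniq : ∀ v ∉ X, ∀ a ∈ X, ∀ b ∈ X, G.Adj v a → G.Adj v b → a = b)
    {P : G.Walk v1 v2} (hP : ∀ v ∈ P.support, v ∉ X) (h1 : G.Adj v1 x) (h2 : G.Adj v2 y)
    (hadj : ∀ v ∈ P.support, ∀ w ∈ X, G.Adj v w → w = x ∨ w = y) :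
    ∃ z, Attached G X x u y z := by
  set D : Set V := {v | ∃ w : G.Walk v1 v, ∀ a ∈ w.support, a ∉ X} with hD
  set T : Set V := {v | ∃ z ∈ X, z ≠ x ∧ z ≠ u ∧ z ≠ y ∧ G.Adj v z} with hT
  have hDX : ∀ v ∈ D, v ∉ X := fun v ⟨w, hw⟩ => hw v (by simp)
  by_cases hr : ∃ r ∈ D, r ∈ T
  swap
  · refine absurd hc (CutPath.not_vertexCritical (a := x) (b := u) (c := y) (D := D)
      (E := {v | v ∉ D ∧ v ≠ x ∧ v ≠ u ∧ v ≠ y}) hℓ hG ⟨hxu, huy, hxy, ?_, ?_, ?_, ?_⟩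
      ⟨v1, .nil, by simpa using hP v1 (by simp)⟩ ⟨e, fun h => hDX e h heX, hex, heu, hey⟩)
    · intro v
      simp only [Set.mem_ofPred_eq]
      tauto
    · exact fun v hv hv' => hv'.1 hv
    · rintro v ⟨w, hw⟩ v' ⟨hv', hx', hu', hy'⟩ hvv'
      by_cases hX : v' ∈ X
      · exact hr ⟨v, ⟨w, hw⟩, v', hX, hx', hu', hy', hvv'⟩
      · refine hv' ⟨w.concat hvv', fun a ha => ?_⟩
        simp only [Walk.support_concat, List.mem_append, List.mem_cons,
          List.not_mem_nil, or_false] at ha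
        rcases ha with ha | rfl
        exacts [hw a ha, hX]
    · rintro v (rfl | rfl | rfl) <;> refine ⟨fun h => hDX _ h ‹_›, fun h => ?_⟩ <;>
        simp at h
  obtain ⟨r₀, ⟨w₀, hw₀⟩, hr₀⟩ := hr
  obtain ⟨k, r, ρ, -, hρ, hk, ⟨z, hz, hzx, hzu, hzy, hrz⟩, -, hρT, -⟩ :=
    exists_shortest_path (A := Xᶜ) (S := {v | v ∈ P.support}) (T := T) w₀ (by simp) hr₀ hw₀
  obtain ⟨p1, p2, rfl⟩ := Walk.mem_support_iff_exists_append.1 hk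
  refine ⟨z, hz, hzx, hzu, hzy, fun F hF hFxy => ?_⟩
  have key : ∀ s : V, ∀ w : G.Walk s k, (∀ v ∈ w.support, v ∈ (p1.append p2).support) →
      ∀ f ∈ F, G.Adj s f → ∃ f ∈ F, ∃ E : G.Walk f z,
      Ear {v | v ∈ X ∧ (v = x ∨ v = u ∨ v = y → v ∈ F)} E ∧
      ∀ v ∈ E.support, v ≠ f → v ≠ z → v ∉ X := by
    intro s w hw f hf hsf
    have hFX : ∀ v ∈ F, v ∈ X := by
      intro v hv
      rcases hF v hv with rfl | rfl | rfl <;> assumption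
    refine exists_ear (w := w.append ρ) (fun v hv => ⟨hFX v hv, fun _ => hv⟩) (fun v hv => hv.1)
      ⟨hz, by tauto⟩ (fun h => by have := hF z h; tauto) hf hsf hrz ?_ ?_ huniq
    · intro v hv
      rw [Walk.mem_support_append_iff] at hv
      rcases hv with hv | hv
      exacts [hP v (hw v hv), hρ v hv]
    · rintro v hv a ⟨haX, haF⟩ hva
      by_cases ha : a = x ∨ a = u ∨ a = y
      · exact .inl (haF ha)
      · push Not at ha
        rw [Walk.mem_support_append_iff] at hv
        rcases hv with hv | hv
        · have := hadj v (hw v hv) a haX hva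
          tauto
        · obtain rfl := hρT v hv ⟨a, haX, ha.1, ha.2.1, ha.2.2, hva⟩
          exact .inr ⟨rfl, huniq v (hρ v hv) a haX z hz hva hrz⟩
  rcases hFxy with hf | hf
  · exact key v1 p1 (fun v hv => Walk.mem_support_append_iff _ _ |>.2 (.inl hv)) x hf h1
  · exact key v2 p2.reverse (fun v hv => Walk.mem_support_append_iff _ _ |>.2
      (.inr (by simpa using hv))) y hf h2

namespace Config

variable {ℓ : ℕ} {u1 u2 u3 u4 x y z : V}
  {P1 : G.Walk u1 u2} {P2 : G.Walk u3 u4} {Q1 : G.Walk u2 u3} {Q2 : G.Walk u1 u4}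
  {L1 : G.Walk u1 u3} {L2 : G.Walk u2 u4}

lemma attached_P2_false (h : Config ℓ P1 P2 Q1 Q2 L1 L2) (hℓ : 5 ≤ ℓ) (hG : InGFamily ℓ G)
    (hl : L1.length = 1) (hx : x ∈ Q1.support) (hx2 : x ≠ u2) (hx3 : G.Adj x u3)
    (hy : y ∈ P2.support) (hy4 : y ≠ u4) (hy3 : G.Adj u3 y) (hxy : x ≠ y)
    (hz : Attached G (arcVerts (k4Arcs P1 P2 Q1 Q2 L1 L2)) x u3 y z) (hzP : z ∈ P2.support) :
    False := by
  obtain ⟨-, hzx, hz3, hzy, hz⟩ := hz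
  obtain ⟨f, hf, E, hE, hX⟩ := hz {x, u3} (by simp) (by simp)
  exact h.ear_P2_false hℓ hG hl hx hx2 hx3 hy hy4 hy3 hxy hzP hz3 hzy hf
    (hE.mono fun v hv => ⟨hv.1, by have := hv.2; simp; tauto⟩) hX

lemma attached_P1_false (h : Config ℓ P1 P2 Q1 Q2 L1 L2) (hℓ : 5 ≤ ℓ) (hG : InGFamily ℓ G)
    (hl : L1.length = 1) (hx : x ∈ Q1.support) (hx2 : x ≠ u2) (hx3 : G.Adj x u3)
    (hy : y ∈ P2.support) (hy4 : y ≠ u4) (hy3 : G.Adj u3 y)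
    (hz : Attached G (arcVerts (k4Arcs P1 P2 Q1 Q2 L1 L2)) x u3 y z) (hzP : z ∈ P1.support)
    (hz1 : z ≠ u1) (hz2 : z ≠ u2) : False := by
  obtain ⟨-, hzx, hz3, hzy, hz⟩ := hz
  obtain ⟨f, hf, E, hE, -⟩ := hz {x, u3, y} (by simp) (by simp)
  replace hE : Ear (arcVerts (k4Arcs P1 P2 Q1 Q2 L1 L2)) E := hE.mono fun v hv => ⟨hv, by simp⟩
  rcases hf with rfl | rfl | rfl
  · obtain ⟨-, hxu, -⟩ := h.swap.swap12.swap34.of_ear_Q1 hℓ hG (by simpa using hzP) hz2 hz1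
      (by simpa using hx) hx3.ne hx2
      (hE.mono (by rw [arcVerts_swap34, arcVerts_swap12, arcVerts_swap]))
    have hq := (h.length_eq_of_L1 hl).2.2.1
    have hQ : Q1.IsPath := h.frame.path ⟨_, _, Q1⟩ (by simp)
    have := hG.le_add_length hQ (q := .cons hxu.symm (.cons hx3 .nil)) (by
      have := h.nodup
      simp [Walk.cons_isPath_iff, hx3.ne] at this ⊢
      exact ⟨hx2.symm, by tauto⟩) (by
      rintro rfl
      simp at hq
      omega)
    simp at this
    omega
  · exact h.swap.swap12.ear_u2_false hℓ hG hzP hz1 hz2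
      (hE.mono (by rw [arcVerts_swap12, arcVerts_swap]))
  · exact h.ear_P1_false hℓ hG hy hy3.ne' hy4 hzP hz1 hz2 hE.reverse

lemma attached_u1_false (h : Config ℓ P1 P2 Q1 Q2 L1 L2) (hℓ : 5 ≤ ℓ) (hG : InGFamily ℓ G)
    (hl : L1.length = 1) (hx : x ∈ Q1.support) (hx2 : x ≠ u2) (hx3 : G.Adj x u3)
    (hy : y ∈ P2.support) (hy4 : y ≠ u4) (hy3 : G.Adj u3 y)
    (hz : Attached G (arcVerts (k4Arcs P1 P2 Q1 Q2 L1 L2)) x u3 y u1) : False := by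
  obtain ⟨-, -, -, -, hz⟩ := hz
  obtain ⟨f, hf, E, hE, hX⟩ := hz {x, y} (by simp) (by simp)
  replace hE : Ear {v | v ∈ arcVerts (k4Arcs P1 P2 Q1 Q2 L1 L2) ∧ v ≠ u3} E :=
    hE.mono fun v hv => ⟨hv.1, by have := hv.2; simp; tauto⟩
  rcases hf with rfl | rfl
  · exact h.ear_u1_false hℓ hG hl hx hx2 hx3 hE hX
  · obtain ⟨hp, -, hq, -⟩ := h.length_eq_of_L1 hl
    exact (h.swapPQ (hp.trans hq.symm)).ear_u1_false hℓ hG hl (by simpa using hy) hy4 hy3.symm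
      (hE.mono (by rw [arcVerts_swapPQ])) (by rwa [arcVerts_swapPQ])

lemma attached_false (h : Config ℓ P1 P2 Q1 Q2 L1 L2) (hℓ : 5 ≤ ℓ) (hG : InGFamily ℓ G)
    (hl : L1.length = 1) (hx : x ∈ Q1.support) (hx2 : x ≠ u2) (hx3 : G.Adj x u3)
    (hy : y ∈ P2.support) (hy4 : y ≠ u4) (hy3 : G.Adj u3 y) (hxy : x ≠ y)
    (hz : Attached G (arcVerts (k4Arcs P1 P2 Q1 Q2 L1 L2)) x u3 y z) : False := by
  obtain ⟨hp, -, hq, -, hl2⟩ := h.length_eq_of_L1 hl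
  have h' := h.swapPQ (hp.trans hq.symm)
  have hz' : Attached G (arcVerts (k4Arcs Q2 Q1.reverse P2.reverse P1 L1 L2.reverse)) y u3 x z :=
    by simpa only [arcVerts_swapPQ] using hz.symm
  have hz3 := hz.2.2.1
  have hend : ∀ {a b : V} {p : G.Walk a b}, p.length = 1 → z ∈ p.support → z = a ∨ z = b := by
    intro a b p hl hz
    match p, hl with
    | .cons h .nil, _ => simpa using hz
  have hP2 : z ∉ P2.support := h.attached_P2_false hℓ hG hl hx hx2 hx3 hy hy4 hy3 hxy hz
  have hQ1 : z ∉ Q1.support := fun hzQ => h'.attached_P2_false hℓ hG hl (by simpa using hy) hy4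
    hy3.symm (by simpa using hx) hx2 hx3.symm hxy.symm hz' (by simpa using hzQ)
  have hz1 : z ≠ u1 := by
    rintro rfl
    exact h.attached_u1_false hℓ hG hl hx hx2 hx3 hy hy4 hy3 hz
  have hz2 : z ≠ u2 := by
    rintro rfl
    exact hQ1 (by simp)
  have hz4 : z ≠ u4 := by
    rintro rfl
    exact hP2 (by simp)
  obtain ⟨a, ha, hza⟩ := hz.1
  simp only [List.mem_cons, List.not_mem_nil, or_false] at ha
  rcases ha with rfl | rfl | rfl | rfl | rfl | rfl
  · exact h.attached_P1_false hℓ hG hl hx hx2 hx3 hy hy4 hy3 hz hza hz1 hz2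
  · exact hP2 hza
  · exact hQ1 hza
  · exact h'.attached_P1_false hℓ hG hl (by simpa using hy) hy4 hy3.symm (by simpa using hx) hx2
      hx3.symm hz' hza hz1 hz4
  · exact (hend hl hza).elim hz1 hz3
  · exact (hend hl2 hza).elim hz2 hz4

end Config
end Attach

section Final

namespace Config

variable {G : SimpleGraph V} {ℓ : ℕ} {u1 u2 u3 u4 x y v1 v2 : V}
  {P1 : G.Walk u1 u2} {P2 : G.Walk u3 u4} {Q1 : G.Walk u2 u3} {Q2 : G.Walk u1 u4}
  {L1 : G.Walk u1 u3} {L2 : G.Walk u2 u4}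

lemma notMem_Q1 (h : Config ℓ P1 P2 Q1 Q2 L1 L2) (hℓ : 5 ≤ ℓ) (hG : InGFamily ℓ G)
    (hc : VertexCritical 4 G) {X : Set V} (hX : arcVerts (k4Arcs P1 P2 Q1 Q2 L1 L2) = X)
    {P : G.Walk v1 v2} (hP : ∀ v ∈ P.support, v ∉ X) (h1 : G.Adj v1 x) (h2 : G.Adj v2 y)
    (hadj : ∀ v ∈ P.support, ∀ w ∈ X, G.Adj v w → w = x ∨ w = y) (hy : y ∈ P2.support)
    (hy3 : y ≠ u3) (hy4 : y ≠ u4) (hxy : x ≠ y) (hx2 : x ≠ u2) (hx3 : x ≠ u3)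
    {E : G.Walk x y} (hE : Ear X E) : x ∉ Q1.support := by
  subst hX
  intro hx
  obtain ⟨hl, hxu, hyu⟩ := h.of_ear_Q1 hℓ hG hy hy3 hy4 hx hx2 hx3 hE
  have hx14 := h.notMem_endQ hx hx2 hx3
  have hy12 := h.notMem_end hy hy3 hy4
  have hu := h.nodup
  simp only [List.nodup_cons, List.mem_cons, List.not_mem_nil, or_false, not_or] at hu
  obtain ⟨z, hz⟩ := exists_attached hℓ hG hc
    (X := arcVerts (k4Arcs P1 P2 Q1 Q2 L1 L2)) (e := u1) ⟨⟨_, _, Q1⟩, by simp, hx⟩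
    ⟨⟨_, _, Q1⟩, by simp, by simp⟩ ⟨⟨_, _, P2⟩, by simp, hy⟩ ⟨⟨_, _, P1⟩, by simp, by simp⟩
    hx14.1.symm hu.1.2.1 hy12.1.symm hxu hyu hxy h.eq_of_adj hP h1 h2 hadj
  exact h.attached_false hℓ hG hl hx hx2 hxu hy hy4 hyu hxy hz

lemma eq_and_adj (h : Config ℓ P1 P2 Q1 Q2 L1 L2) (hℓ : 5 ≤ ℓ) (hG : InGFamily ℓ G)
    (hc : VertexCritical 4 G) {X : Set V} (hX : arcVerts (k4Arcs P1 P2 Q1 Q2 L1 L2) = X)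
    {P : G.Walk v1 v2} (hP : ∀ v ∈ P.support, v ∉ X) (h1 : G.Adj v1 x) (h2 : G.Adj v2 y)
    (hadj : ∀ v ∈ P.support, ∀ w ∈ X, G.Adj v w → w = x ∨ v = v2 ∧ w = y)
    (hy : y ∈ P2.support) (hy3 : y ≠ u3) (hy4 : y ≠ u4) (hx : x ∈ X)
    (hxP : x ∈ P2.support → x = u3 ∨ x = u4) : (x = u3 ∨ x = u4) ∧ G.Adj x y := by
  have hyX : y ∈ X := hX ▸ ⟨⟨_, _, P2⟩, by simp, hy⟩
  have hxy : x ≠ y := by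
    rintro rfl
    exact (hxP hy).elim hy3 hy4
  obtain ⟨E, hE⟩ : ∃ E : G.Walk x y, Ear X E := by
    obtain ⟨_, rfl, E, hE, -⟩ := exists_ear (X := X) (F := {x}) (w := P) (by simpa using hx) le_rfl
      hyX (by simpa using hxy.symm) rfl h1 h2 hP hadj (hX ▸ h.eq_of_adj)
    exact ⟨E, hE⟩
  have hE' := hE.mono hX.le
  replace hadj : ∀ v ∈ P.support, ∀ w ∈ X, G.Adj v w → w = x ∨ w = y := fun v hv w hw hvw =>
    (hadj v hv w hw hvw).imp_right And.right
  have hyr : y ∈ P2.reverse.support := by simpa using hy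
  by_cases hx3 : x = u3
  · subst hx3
    exact ⟨.inl rfl, h.adj_of_ear_u3 hℓ hG hy hy3 hy4 hE'⟩
  by_cases hx4 : x = u4
  · subst hx4
    exact ⟨.inr rfl, h.swap34.adj_of_ear_u3 hℓ hG hyr hy4 hy3 (hE'.mono arcVerts_swap34.le)⟩
  exfalso
  have hx1 : x ≠ u1 := by
    rintro rfl
    exact h.swap12.ear_u2_false hℓ hG hy hy3 hy4 (hE'.mono arcVerts_swap12.le)
  have hx2 : x ≠ u2 := by
    rintro rfl
    exact h.ear_u2_false hℓ hG hy hy3 hy4 hE'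
  rw [← hX] at hx
  obtain ⟨a, ha, hxa⟩ := hx
  simp only [List.mem_cons, List.not_mem_nil, or_false] at ha
  rcases ha with rfl | rfl | rfl | rfl | rfl | rfl
  · exact h.ear_P1_false hℓ hG hy hy3 hy4 hxa hx1 hx2 hE'
  · exact (hxP hxa).elim hx3 hx4
  · exact h.notMem_Q1 hℓ hG hc hX hP h1 h2 hadj hy hy3 hy4 hxy hx2 hx3 hE hxa
  · exact h.swap12.swap34.notMem_Q1 hℓ hG hc (by rw [arcVerts_swap34, arcVerts_swap12, hX]) hP h1
      h2 hadj hyr hy4 hy3 hxy hx1 hx4 hE hxa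
  · exact h.swap12.notMem_Q1 hℓ hG hc (by rw [arcVerts_swap12, hX]) hP h1 h2 hadj hy hy3 hy4 hxy
      hx1 hx3 hE hxa
  · exact h.swap34.notMem_Q1 hℓ hG hc (by rw [arcVerts_swap34, hX]) hP h1 h2 hadj hyr hy4 hy3 hxy
      hx2 hx4 hE hxa

lemma getVert_one (h : Config ℓ P1 P2 Q1 Q2 L1 L2) (hℓ : 5 ≤ ℓ) (hG : InGFamily ℓ G)
    (hy : y ∈ P2.support) (hy3 : G.Adj u3 y) : P2.getVert 1 = y := by
  obtain ⟨T1, T2, rfl, hT⟩ := h.exists_append_P2 hℓ hG hy hy3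
  match T1, hT with
  | .cons _ .nil, _ => simp

end Config
end Final

/-- Claim 3.6: in the setup of the proof of Theorem 1.2, the
attachment vertex `x` is `u3` or `u4`, and the edge `xy` is `e` or `f`. -/
theorem claim_x_is_u3_or_u4 {V : Type*}
    (ℓ : ℕ) (hℓ : 5 ≤ ℓ) (G : SimpleGraph V)
    (hG : InGFamily ℓ G) (hcrit : VertexCritical 4 G)
    (K : OddK4 G) (hlong : K.longestPair)
    (hmin : ∀ K' : OddK4 G, K'.longestPair → K.diff ≤ K'.diff)
    (e f : Sym2 V)
    (he : e = s(K.u3, K.P2.getVert 1))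
    (hf : f = s(K.u4, K.P2.getVert (K.P2.length - 1)))
    (v1 v2 : V) (P : (G.deleteEdges {e, f}).Walk v1 v2)
    (hPind : IsInducedPath (G.deleteEdges {e, f}) P)
    (hPdisj : ∀ w ∈ P.support, w ∉ K.verts)
    (hv2nbr : ∃ z ∈ interiorL K.P2, (G.deleteEdges {e, f}).Adj v2 z)
    (hv2only : ∀ w ∈ P.support,
      (∃ z ∈ interiorL K.P2, (G.deleteEdges {e, f}).Adj w z) → w = v2)
    (hv1nbr : ∃ z : V, z ∈ K.verts ∧ z ∉ interiorL K.P2 ∧ (G.deleteEdges {e, f}).Adj v1 z)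
    (hv1only : ∀ w ∈ P.support,
      (∃ z : V, z ∈ K.verts ∧ z ∉ interiorL K.P2 ∧ (G.deleteEdges {e, f}).Adj w z) → w = v1)
    (x y : V)
    (hy : y ∈ interiorL K.P2) (hv2y : G.Adj v2 y)
    (hyuniq : ∀ z ∈ interiorL K.P2, G.Adj v2 z → z = y)
    (hxH : x ∈ K.verts) (hxP2 : x ∉ interiorL K.P2) (hv1x : G.Adj v1 x)
    (hxuniq : ∀ z : V, z ∈ K.verts → z ∉ interiorL K.P2 → G.Adj v1 z → z = x)
    : (x = K.u3 ∨ x = K.u4) ∧ G.Adj x y ∧ (s(x, y) = e ∨ s(x, y) = f) := by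
  have hK := OddK4.toConfig hℓ hG hlong hmin
  have hX : arcVerts (k4Arcs K.P1 K.P2 K.Q1 K.Q2 K.L1 K.L2) = K.verts :=
    Set.ext fun v => K.mem_verts.symm
  have hP2 : ∀ i, K.P2.getVert i ∈ K.verts := fun i =>
    K.mem_verts.2 ⟨⟨_, _, K.P2⟩, by simp, K.P2.getVert_mem_support i⟩
  have hdel : ∀ v ∉ K.verts, ∀ w, G.Adj v w → (G.deleteEdges {e, f}).Adj v w := by
    intro v hv w hvw
    rw [deleteEdges_adj]
    refine ⟨hvw, ?_⟩
    have h3 : K.u3 ∈ K.verts := by simpa using hP2 0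
    have h4 : K.u4 ∈ K.verts := by simpa using hP2 K.P2.length
    rintro (h | h)
    · have hve : v ∈ e := h ▸ Sym2.mem_mk_left v w
      rw [he, Sym2.mem_iff] at hve
      rcases hve with rfl | rfl
      exacts [hv h3, hv (hP2 1)]
    · have hvf : v ∈ f := h ▸ Sym2.mem_mk_left v w
      rw [hf, Sym2.mem_iff] at hvf
      rcases hvf with rfl | rfl
      exacts [hv h4, hv (hP2 _)]
  obtain ⟨hyP, hy3, hy4⟩ := (mem_interiorL K.hP2).1 hy
  have hxy := hK.eq_and_adj hℓ hG hcrit hX (P := P.mapLe (deleteEdges_le _)) (x := x) (y := y)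
    (by simpa using hPdisj) hv1x hv2y (by
      intro v hv w hw hvw
      replace hv : v ∈ P.support := by simpa using hv
      have hvw' := hdel v (hPdisj v hv) w hvw
      by_cases hwP : w ∈ interiorL K.P2
      · obtain rfl := hv2only v hv ⟨w, hwP, hvw'⟩
        exact .inr ⟨rfl, hyuniq w hwP hvw⟩
      · obtain rfl := hv1only v hv ⟨w, hw, hwP, hvw'⟩
        exact .inl (hxuniq w hw hwP hvw)) hyP hy3 hy4 hxH (by
      intro h
      by_contra! hne
      exact hxP2 ((mem_interiorL K.hP2).2 ⟨h, hne⟩))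
  refine ⟨hxy.1, hxy.2, ?_⟩
  obtain ⟨rfl | rfl, hadj⟩ := hxy
  · exact .inl (by rw [he, hK.getVert_one hℓ hG hyP hadj])
  · right
    have := hK.swap34.getVert_one hℓ hG (by simpa using hyP) hadj
    rw [Walk.getVert_reverse] at this
    rw [hf, this]
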